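/- A function f ∈ H¹(Γ) is outer (in Royden's sense) if and only if f ∘ τ is outer in H¹(𝕋). -/

import Mathlib

open MeasureTheory Metric Complex Filter Set
open scoped ENNReal Topology

noncomputable section

/-- `u` is harmonic (real-valued) on an open set `U ⊆ ℂ`: locally the real part of a
holomorphic function. -/
def IsHarmonicOn (u : ℂ → ℝ) (U : Set ℂ) : Prop :=
  ∀ z ∈ U, ∃ r > 0, ball z r ⊆ U ∧ ∃ g : ℂ → ℂ,
    DifferentiableOn ℂ g (ball z r) ∧ ∀ w ∈ ball z r, u w = (g w).re

/-- An analytic boundary curve: the image of an injective analytic immersion of the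
unit circle. -/
def IsAnalyticCurve (C : Set ℂ) : Prop :=
  ∃ γ : ℂ → ℂ, AnalyticOnNhd ℂ γ (sphere (0:ℂ) 1) ∧ Set.InjOn γ (sphere (0:ℂ) 1) ∧
    γ '' (sphere (0:ℂ) 1) = C ∧ ∀ z ∈ sphere (0:ℂ) 1, deriv γ z ≠ 0

/-- Nontangential limit `L` of `g` at a boundary point `ζ` of `Ω`: convergence within
every cone-like approach region of aperture `a > 1`. -/
def NTLim (Ω : Set ℂ) (g : ℂ → ℂ) (ζ : ℂ) (L : ℂ) : Prop :=
  ∀ a : ℝ, 1 < a →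
    Tendsto g (𝓝[{z ∈ Ω | ‖z - ζ‖ < a * infDist z Ωᶜ}] ζ) (𝓝 L)

/-- A bounded finitely connected planar domain `Ω` with analytic boundary components
`Γ 0, …, Γ n` (`Γ 0` the outer one), a base point `w₀ ∈ Ω`, and the family of harmonic
measures `ωm w` (probability measures on the boundary reproducing functions harmonic on
`Ω` and continuous on its closure). -/
structure MCDomain (n : ℕ) where
  Ω : Set ℂ
  Γ : Fin (n+1) → Set ℂ
  w₀ : ℂ
  ωm : ℂ → Measure ℂ
  isOpen : IsOpen Ω
  conn : IsConnected Ω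
  bdd : Bornology.IsBounded Ω
  base_mem : w₀ ∈ Ω
  frontier_eq : frontier Ω = ⋃ j, Γ j
  disj : ∀ j k, j ≠ k → Disjoint (Γ j) (Γ k)
  curve : ∀ j, IsAnalyticCurve (Γ j)
  outer_comp : ∀ j, j ≠ 0 → ∀ ζ ∈ Γ j, ζ ∈ closure (interior (closure (Ω ∪ Γ 0)))
  prob : ∀ w ∈ Ω, IsProbabilityMeasure (ωm w)
  supp : ∀ w ∈ Ω, ωm w (frontier Ω)ᶜ = 0
  dirichlet : ∀ u : ℂ → ℝ, ContinuousOn u (closure Ω) → IsHarmonicOn u Ω →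
    ∀ w ∈ Ω, u w = ∫ ζ, u ζ ∂(ωm w)

variable {n : ℕ}

/-- Harmonic measure at the base point. -/
def MCDomain.ω (D : MCDomain n) : Measure ℂ := D.ωm D.w₀

/-- `H^∞(Γ)`: boundary functions (via nontangential limits a.e.) of bounded analytic
functions on `Ω`. -/
def MCDomain.Hinf (D : MCDomain n) : Set (ℂ → ℂ) :=
  {ψ | ∃ g : ℂ → ℂ, DifferentiableOn ℂ g D.Ω ∧ (∃ C : ℝ, ∀ z ∈ D.Ω, ‖g z‖ ≤ C) ∧
    ∀ᵐ ζ ∂D.ω, NTLim D.Ω g ζ (ψ ζ)}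

/-- `H²(Γ)`: boundary functions of analytic functions on `Ω` such that `|g|²` has a
harmonic majorant. -/
def MCDomain.H2 (D : MCDomain n) : Set (ℂ → ℂ) :=
  {ψ | ∃ g : ℂ → ℂ, DifferentiableOn ℂ g D.Ω ∧
    (∃ h : ℂ → ℝ, IsHarmonicOn h D.Ω ∧ ∀ z ∈ D.Ω, ‖g z‖ ^ 2 ≤ h z) ∧
    ∀ᵐ ζ ∂D.ω, NTLim D.Ω g ζ (ψ ζ)}

/-- `H¹(Γ)`: boundary functions of analytic functions on `Ω` such that `|g|` has a
harmonic majorant. -/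
def MCDomain.H1 (D : MCDomain n) : Set (ℂ → ℂ) :=
  {ψ | ∃ g : ℂ → ℂ, DifferentiableOn ℂ g D.Ω ∧
    (∃ h : ℂ → ℝ, IsHarmonicOn h D.Ω ∧ ∀ z ∈ D.Ω, ‖g z‖ ≤ h z) ∧
    ∀ᵐ ζ ∂D.ω, NTLim D.Ω g ζ (ψ ζ)}

/-- `ψ` is (the boundary function of) an outer function on `Ω` in Royden's sense:
`log|g(w)| = ∫_Γ log|ψ| dω_w` for all `w ∈ Ω`. -/
def MCDomain.IsOuter (D : MCDomain n) (ψ : ℂ → ℂ) : Prop :=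
  ∃ g : ℂ → ℂ, DifferentiableOn ℂ g D.Ω ∧ (∀ᵐ ζ ∂D.ω, NTLim D.Ω g ζ (ψ ζ)) ∧
    ∀ w ∈ D.Ω, Real.log ‖g w‖ = ∫ ζ, Real.log ‖ψ ζ‖ ∂(D.ωm w)

/-- Royden inner function (boundary form): a member of `H^∞(Γ)` whose modulus is
a.e. constant on each boundary component. -/
def MCDomain.IsInner (D : MCDomain n) (φ : ℂ → ℂ) : Prop :=
  φ ∈ D.Hinf ∧ ∀ j, ∃ c : ℝ, ∀ᵐ ζ ∂D.ω, ζ ∈ D.Γ j → ‖φ ζ‖ = c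

/-- Normalized Lebesgue measure `m` on the unit circle in `ℂ`. -/
def circleMeasure : Measure ℂ :=
  (ENNReal.ofReal (2 * Real.pi))⁻¹ •
    Measure.map (fun t : ℝ => Complex.exp (t * Complex.I))
      (volume.restrict (Ioc (0:ℝ) (2 * Real.pi)))

/-- The Poisson (harmonic) measure `dm_z = P_z dm` on the circle, for `z` in the disk. -/
def poissonMeasure (z : ℂ) : Measure ℂ :=
  circleMeasure.withDensity (fun ζ => ENNReal.ofReal ((1 - ‖z‖ ^ 2) / ‖ζ - z‖ ^ 2))

/-- A conformal automorphism of the unit disk, as a globally defined Möbius map. -/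
def IsDiskAut (σ : ℂ → ℂ) : Prop :=
  ∃ c a : ℂ, ‖c‖ = 1 ∧ ‖a‖ < 1 ∧ ∀ z, σ z = c * ((z - a) / (1 - (starRingEnd ℂ) a * z))

/-- `σ` is a deck transformation (an element of the covering group `𝔊`) of `τ`. -/
def IsDeck (τ σ : ℂ → ℂ) : Prop :=
  IsDiskAut σ ∧ ∀ z ∈ ball (0:ℂ) 1, τ (σ z) = τ z

/-- `τ` is an analytic covering map of the unit disk onto `Ω` with `τ 0 = w₀` and
`τ'(0) > 0`. -/
structure IsCoveringOfDisk (Ω : Set ℂ) (w₀ : ℂ) (τ : ℂ → ℂ) : Prop where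
  diff : DifferentiableOn ℂ τ (ball 0 1)
  mapsTo : ∀ z ∈ ball (0:ℂ) 1, τ z ∈ Ω
  surj : Ω ⊆ τ '' (ball 0 1)
  base : τ 0 = w₀
  deriv_pos : (deriv τ 0).im = 0 ∧ 0 < (deriv τ 0).re
  evenly : ∀ w ∈ Ω, ∃ r > 0, ball w r ⊆ Ω ∧ ∀ z ∈ ball (0:ℂ) 1, τ z ∈ ball w r →
    BijOn τ (connectedComponentIn (ball 0 1 ∩ τ ⁻¹' ball w r) z) (ball w r)

/-- `τb` is the (measurable, a.e.-defined via nontangential limits) boundary function of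
`τ` on the unit circle, mapping into the boundary of `Ω`. -/
def IsBoundaryMap (Ω : Set ℂ) (τ τb : ℂ → ℂ) : Prop :=
  Measurable τb ∧
    ∀ᵐ ζ ∂circleMeasure, NTLim (ball 0 1) τ ζ (τb ζ) ∧ τb ζ ∈ frontier Ω

/-- `ψ` is (the boundary function of) an outer function in `H¹(𝕋)` on the unit disk:
`log|g(z)| = ∫ log|ψ| dm_z` for the analytic function `g` with boundary values `ψ`. -/
def DiskOuter (ψ : ℂ → ℂ) : Prop :=
  ∃ g : ℂ → ℂ, DifferentiableOn ℂ g (ball 0 1) ∧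
    (∀ᵐ ζ ∂circleMeasure, NTLim (ball 0 1) g ζ (ψ ζ)) ∧
    ∀ z ∈ ball (0:ℂ) 1, Real.log ‖g z‖ = ∫ ζ, Real.log ‖ψ ζ‖ ∂(poissonMeasure z)

theorem nhds_le_map_of_injOn {f : ℂ → ℂ} {U : Set ℂ} (hU : IsOpen U)
    (hf : DifferentiableOn ℂ f U) (hinj : InjOn f U) {z : ℂ} (hz : z ∈ U) :
    𝓝 (f z) ≤ map f (𝓝 z) := by
  refine (AnalyticAt.eventually_constant_or_nhds_le_map_nhds
    (hf.analyticAt (hU.mem_nhds hz))).resolve_left fun h => ?_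
  have h1 : ∀ᶠ y in 𝓝 z, y = z := by
    filter_upwards [h, hU.mem_nhds hz] with y hy hyU using hinj hyU hz hy
  have : (𝓝[≠] z).NeBot := inferInstance
  obtain ⟨y, hy1, hy2⟩ := ((h1.filter_mono nhdsWithin_le_nhds).and
    (self_mem_nhdsWithin (s := {z}ᶜ) (a := z))).exists
  exact hy2 hy1

/-- An injective holomorphic function is open. -/
theorem isOpen_image_of_injOn {f : ℂ → ℂ} {U V : Set ℂ} (hU : IsOpen U)
    (hf : DifferentiableOn ℂ f U) (hinj : InjOn f U) (hV : IsOpen V) (hVU : V ⊆ U) :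
    IsOpen (f '' V) := by
  rw [isOpen_iff_mem_nhds]
  rintro _ ⟨z, hz, rfl⟩
  exact nhds_le_map_of_injOn hU hf hinj (hVU hz) (image_mem_map (hV.mem_nhds hz))

/-- An injective holomorphic function has a holomorphic inverse on its image. -/
theorem exists_holomorphic_inverse {f : ℂ → ℂ} {U : Set ℂ} (hU : IsOpen U)
    (hf : DifferentiableOn ℂ f U) (hinj : InjOn f U) :
    ∃ t : ℂ → ℂ, DifferentiableOn ℂ t (f '' U) ∧ ∀ z ∈ U, t (f z) = z := by
  set t := Function.invFunOn f U
  have ht : ∀ z ∈ U, t (f z) = z := fun z hz => hinj.leftInvOn_invFunOn hz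
  refine ⟨t, ?_, ht⟩
  have hcont : ∀ z ∈ U, ContinuousAt t (f z) := by
    intro z hz
    rw [ContinuousAt, ht z hz]
    refine (tendsto_map' ?_ : Tendsto t (map f (𝓝 z)) (𝓝 z)).mono_left
      (nhds_le_map_of_injOn hU hf hinj hz)
    refine tendsto_id.congr' ?_
    filter_upwards [hU.mem_nhds hz] with y hy using (ht y hy).symm
  have hopen : IsOpen (f '' U) := isOpen_image_of_injOn hU hf hinj hU subset_rfl
  have hright : ∀ w ∈ f '' U, f (t w) = w := by
    rintro _ ⟨z, hz, rfl⟩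
    rw [ht z hz]
  have hdiff : ∀ z ∈ U, deriv f z ≠ 0 → DifferentiableAt ℂ t (f z) := by
    intro z hz hd
    have h1 : HasDerivAt f (deriv f z) (t (f z)) := by
      rw [ht z hz]
      exact (hf.differentiableAt (hU.mem_nhds hz)).hasDerivAt
    refine (HasDerivAt.of_local_left_inverse (hcont z hz) h1 hd ?_).differentiableAt
    filter_upwards [hopen.mem_nhds (mem_image_of_mem f hz)] with w hw using hright w hw
  rintro _ ⟨z, hz, rfl⟩
  refine DifferentiableAt.differentiableWithinAt ?_
  have han : AnalyticAt ℂ (deriv f) z := (hf.analyticAt (hU.mem_nhds hz)).deriv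
  rcases han.eventually_eq_zero_or_eventually_ne_zero with h0 | h0
  · exfalso
    obtain ⟨r, hr, hball⟩ := Metric.mem_nhds_iff.1 (inter_mem h0 (hU.mem_nhds hz))
    have hconst : ∀ y ∈ ball z r, f y = f z := by
      intro y hy
      refine (convex_ball z r).is_const_of_fderivWithin_eq_zero (𝕜 := ℂ)
        (hf.mono fun x hx => (hball hx).2) ?_ hy (mem_ball_self hr)
      intro x hx
      rw [fderivWithin_of_isOpen isOpen_ball hx]
      ext
      have : deriv f x = 0 := (hball hx).1
      simpa using this
    have hz' : z + (r / 2 : ℝ) ∈ ball z r := by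
      simp [abs_of_pos hr, hr]
    have := hinj (hball hz').2 hz (hconst _ hz')
    simp [hr.ne'] at this
  · have hev : ∀ᶠ y in 𝓝 z, y ≠ z → deriv f y ≠ 0 := eventually_nhdsWithin_iff.1 h0
    have hev' := (hcont z hz).tendsto.eventually (by rw [ht z hz]; exact hev)
    have : ∀ᶠ w in 𝓝[≠] (f z), DifferentiableAt ℂ t w := by
      rw [eventually_nhdsWithin_iff]
      filter_upwards [hev', hopen.mem_nhds (mem_image_of_mem f hz)] with w hw hwU hne
      obtain ⟨y, hy, rfl⟩ := hwU
      rw [ht y hy] at hw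
      exact hdiff y hy (hw fun h => hne (by rw [h]; rfl))
    exact (Complex.analyticAt_of_differentiable_on_punctured_nhds_of_continuousAt this
      (hcont z hz)).differentiableAt

section Covering

variable {Ω : Set ℂ} {w₀ : ℂ} {τ : ℂ → ℂ}

theorem IsCoveringOfDisk.isCoveringMapOn (hτ : IsCoveringOfDisk Ω w₀ τ) :
    IsCoveringMapOn (fun z : ball (0:ℂ) 1 => τ z) Ω := by
  intro w hw
  obtain ⟨r, hr, hrΩ, hbij⟩ := hτ.evenly w hw
  set p : ball (0:ℂ) 1 → ℂ := fun z => τ z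
  have hpc : Continuous p := hτ.diff.continuousOn.domRestrict
  set C : ℂ → Set ℂ := connectedComponentIn (ball 0 1 ∩ τ ⁻¹' ball w r)
  have hOpen : IsOpen (ball 0 1 ∩ τ ⁻¹' ball w r) :=
    hτ.diff.continuousOn.isOpen_inter_preimage isOpen_ball isOpen_ball
  have hCo : ∀ z, IsOpen (C z) := fun z => hOpen.connectedComponentIn
  have hCs : ∀ z, C z ⊆ ball 0 1 ∩ τ ⁻¹' ball w r := fun z => connectedComponentIn_subset _ _
  have hfib : ∀ i : p ⁻¹' {w}, τ i.1 = w := fun i => i.2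
  have hmem : ∀ i : p ⁻¹' {w}, (i.1 : ℂ) ∈ ball 0 1 ∩ τ ⁻¹' ball w r := fun i =>
    ⟨i.1.2, by rw [mem_preimage, hfib i]; exact mem_ball_self hr⟩
  have hb : ∀ i : p ⁻¹' {w}, BijOn τ (C i.1) (ball w r) := fun i =>
    hbij _ i.1.2 (hmem i).2
  have hne : Nonempty (p ⁻¹' {w}) := by
    obtain ⟨z, hz, hzw⟩ := hτ.surj hw
    exact ⟨⟨⟨z, hz⟩, hzw⟩⟩
  have : Nonempty (ball (0:ℂ) 1) := ⟨⟨0, by simp⟩⟩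
  let U : p ⁻¹' {w} → Set (ball (0:ℂ) 1) := fun i => {z | (z : ℂ) ∈ C i.1}
  have hUo : ∀ i, IsOpen (U i) := fun i => (hCo i.1).preimage continuous_subtype_val
  have hdisj : Pairwise (Function.onFun Disjoint U) := by
    intro i j hij
    rw [Function.onFun, Set.disjoint_left]
    intro z hzi hzj
    apply hij
    have h1 : C i.1 = C z := connectedComponentIn_eq hzi
    have h2 : C j.1 = C z := connectedComponentIn_eq hzj
    have h3 : (j.1 : ℂ) ∈ C i.1 := by
      rw [h1, ← h2]
      exact mem_connectedComponentIn (hmem j)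
    have := (hb i).injOn (mem_connectedComponentIn (hmem i)) h3 ((hfib i).trans (hfib j).symm)
    exact Subtype.ext (Subtype.ext this)
  have hdisc : DiscreteTopology (p ⁻¹' {w}) := by
    rw [discreteTopology_iff_isOpen_singleton]
    intro i
    refine ⟨U i, hUo i, ?_⟩
    ext j
    simp only [mem_preimage, mem_singleton_iff]
    constructor
    · intro hj
      by_contra hne'
      exact Set.disjoint_left.1 (hdisj hne') (show j.1 ∈ U j from
        mem_connectedComponentIn (hmem j)) hj
    · rintro rfl
      exact mem_connectedComponentIn (hmem j)
  refine .of_trivialization (t := IsOpen.trivializationDiscrete U (ball w r) isOpen_ball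
    ?_ ?_ ?_ hdisj ?_) (mem_ball_self hr)
  · intro i W hW
    refine ⟨fun h => (h.preimage hpc).inter (hUo i), fun h => ?_⟩
    have hV : IsOpen (Subtype.val '' (p ⁻¹' W ∩ U i)) := isOpen_ball.isOpenMap_subtype_val _ h
    have himg : τ '' (Subtype.val '' (p ⁻¹' W ∩ U i)) = W := by
      ext y
      constructor
      · rintro ⟨_, ⟨z, hz, rfl⟩, rfl⟩
        exact hz.1
      · intro hy
        obtain ⟨z, hz, rfl⟩ := (hb i).surjOn (hW hy)
        exact ⟨z, ⟨⟨z, (hCs _ hz).1⟩, ⟨hy, hz⟩, rfl⟩, rfl⟩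
    rw [← himg]
    refine isOpen_image_of_injOn (hCo i.1) (hτ.diff.mono fun z hz => (hCs _ hz).1)
      (hb i).injOn hV ?_
    rintro _ ⟨z, hz, rfl⟩
    exact hz.2
  · intro i z hz z' hz' h
    exact Subtype.ext ((hb i).injOn hz hz' h)
  · intro i y hy
    obtain ⟨z, hz, rfl⟩ := (hb i).surjOn hy
    exact ⟨⟨z, (hCs _ hz).1⟩, hz, rfl⟩
  · intro z hz
    have hz' : (z : ℂ) ∈ ball 0 1 ∩ τ ⁻¹' ball w r := ⟨z.2, hz⟩
    obtain ⟨y, hy, hyw⟩ := (hbij z z.2 hz).surjOn (mem_ball_self hr)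
    refine mem_iUnion.2 ⟨⟨⟨y, (hCs _ hy).1⟩, hyw⟩, ?_⟩
    change (z : ℂ) ∈ C y
    have h : C z = C y := connectedComponentIn_eq hy
    rw [← h]
    exact mem_connectedComponentIn hz'

/-- A continuous lift of a holomorphic function through the covering is holomorphic. -/
theorem IsCoveringOfDisk.differentiableOn_lift (hτ : IsCoveringOfDisk Ω w₀ τ) {Q : Set ℂ}
    (hQ : IsOpen Q) {k s : ℂ → ℂ} (hk : DifferentiableOn ℂ k Q) (hs : ContinuousOn s Q)
    (hsb : ∀ x ∈ Q, s x ∈ ball (0:ℂ) 1) (hlift : ∀ x ∈ Q, τ (s x) = k x) :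
    DifferentiableOn ℂ s Q := by
  intro x hx
  obtain ⟨r, hr, hrΩ, hbij⟩ := hτ.evenly (τ (s x)) (hτ.mapsTo _ (hsb x hx))
  set C := connectedComponentIn (ball 0 1 ∩ τ ⁻¹' ball (τ (s x)) r) (s x)
  have hb : BijOn τ C (ball (τ (s x)) r) := hbij _ (hsb x hx) (mem_ball_self hr)
  have hCo : IsOpen C := (hτ.diff.continuousOn.isOpen_inter_preimage isOpen_ball
    isOpen_ball).connectedComponentIn
  have hCs : C ⊆ ball 0 1 ∩ τ ⁻¹' ball (τ (s x)) r := connectedComponentIn_subset _ _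
  have hxC : s x ∈ C := mem_connectedComponentIn ⟨hsb x hx, mem_ball_self hr⟩
  obtain ⟨t, ht, htinv⟩ := exists_holomorphic_inverse hCo
    (hτ.diff.mono fun z hz => (hCs hz).1) hb.injOn
  have hsx : ContinuousAt s x := hs.continuousAt (hQ.mem_nhds hx)
  have heq : s =ᶠ[𝓝 x] fun y => t (k y) := by
    filter_upwards [hsx.preimage_mem_nhds (hCo.mem_nhds hxC), hQ.mem_nhds hx] with y hy hyQ
    rw [← hlift y hyQ, htinv _ hy]
  have hkx : k x ∈ τ '' C := ⟨s x, hxC, hlift x hx⟩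
  have hto : IsOpen (τ '' C) := by rw [hb.image_eq]; exact isOpen_ball
  refine DifferentiableAt.differentiableWithinAt (heq.differentiableAt_iff.2 ?_)
  exact (ht.differentiableAt (hto.mem_nhds hkx)).comp x (hk.differentiableAt (hQ.mem_nhds hx))

/-- Holomorphic functions on convex open sets lift through the covering. -/
theorem IsCoveringOfDisk.exists_lift (hτ : IsCoveringOfDisk Ω w₀ τ) {Q : Set ℂ}
    (hQ : IsOpen Q) (hQc : Convex ℝ Q) {k : ℂ → ℂ} (hk : DifferentiableOn ℂ k Q)
    (hkΩ : ∀ x ∈ Q, k x ∈ Ω) {x₁ z₁ : ℂ} (hx₁ : x₁ ∈ Q) (hz₁ : z₁ ∈ ball (0:ℂ) 1)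
    (h₁ : τ z₁ = k x₁) :
    ∃ s : ℂ → ℂ, DifferentiableOn ℂ s Q ∧ (∀ x ∈ Q, s x ∈ ball (0:ℂ) 1) ∧
      (∀ x ∈ Q, τ (s x) = k x) ∧ s x₁ = z₁ := by
  have : ContractibleSpace Q := hQc.contractibleSpace ⟨x₁, hx₁⟩
  have : LocallyPathConnectedSpace Q := hQ.locallyPathConnectedSpace
  let kQ : C(Q, ℂ) := ⟨Q.domRestrict k, hk.continuousOn.domRestrict⟩
  obtain ⟨F, ⟨hF1, hF2⟩, -⟩ := hτ.isCoveringMapOn.existsUnique_continuousMap_lifts kQ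
    (a₀ := ⟨x₁, hx₁⟩) (e₀ := ⟨z₁, hz₁⟩) h₁ (fun a => hkΩ _ a.2)
  classical
  let s : ℂ → ℂ := fun x => if h : x ∈ Q then (F ⟨x, h⟩ : ℂ) else 0
  have hs : ∀ x (h : x ∈ Q), s x = F ⟨x, h⟩ := fun x h => dif_pos h
  have hsc : ContinuousOn s Q := by
    rw [continuousOn_iff_continuous_domRestrict]
    have : Q.domRestrict s = fun x => (F x : ℂ) := by
      ext x
      exact hs x x.2
    rw [this]
    fun_prop
  have hsb : ∀ x ∈ Q, s x ∈ ball (0:ℂ) 1 := fun x hx => by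
    rw [hs x hx]; exact (F ⟨x, hx⟩).2
  have hl : ∀ x ∈ Q, τ (s x) = k x := fun x hx => by
    rw [hs x hx]; exact congrFun hF2 ⟨x, hx⟩
  refine ⟨s, hτ.differentiableOn_lift hQ hk hsc hsb hl, hsb, hl, ?_⟩
  rw [hs _ hx₁, hF1]

/-- Lifts through the covering are unique on preconnected sets. -/
theorem IsCoveringOfDisk.eqOn_of_comp_eq (hτ : IsCoveringOfDisk Ω w₀ τ) {S : Set ℂ}
    (hS : IsPreconnected S) {s₁ s₂ : ℂ → ℂ} (h₁ : ContinuousOn s₁ S) (h₂ : ContinuousOn s₂ S)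
    (hb₁ : ∀ x ∈ S, s₁ x ∈ ball (0:ℂ) 1) (hb₂ : ∀ x ∈ S, s₂ x ∈ ball (0:ℂ) 1)
    (he : ∀ x ∈ S, τ (s₁ x) = τ (s₂ x)) {a : ℂ} (ha : a ∈ S) (hea : s₁ a = s₂ a) :
    ∀ x ∈ S, s₁ x = s₂ x := by
  have hcov := hτ.isCoveringMapOn.isCoveringMap_restrictPreimage
  have : PreconnectedSpace S := isPreconnected_iff_preconnectedSpace.1 hS
  let E := (fun z : ball (0:ℂ) 1 => τ z) ⁻¹' Ω
  let g₁ : S → E := fun x => ⟨⟨s₁ x, hb₁ x x.2⟩, hτ.mapsTo _ (hb₁ x x.2)⟩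
  let g₂ : S → E := fun x => ⟨⟨s₂ x, hb₂ x x.2⟩, hτ.mapsTo _ (hb₂ x x.2)⟩
  have hc₁ : Continuous g₁ := (h₁.domRestrict.subtype_mk _).subtype_mk _
  have hc₂ : Continuous g₂ := (h₂.domRestrict.subtype_mk _).subtype_mk _
  have := hcov.eq_of_comp_eq hc₁ hc₂ (funext fun x => Subtype.ext (he x x.2)) ⟨a, ha⟩
    (Subtype.ext (Subtype.ext hea))
  intro x hx
  exact congrArg (fun e : E => (e.1 : ℂ)) (congrFun this ⟨x, hx⟩)

end Covering

section SchwarzPick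

theorem norm_sub_sq_mobius (a w : ℂ) :
    ‖1 - (starRingEnd ℂ) a * w‖ ^ 2 - ‖w - a‖ ^ 2 = (1 - ‖a‖ ^ 2) * (1 - ‖w‖ ^ 2) := by
  simp only [← Complex.normSq_eq_norm_sq, Complex.normSq_apply, Complex.sub_re, Complex.sub_im,
    Complex.mul_re, Complex.mul_im, Complex.conj_re, Complex.conj_im, Complex.one_re,
    Complex.one_im]
  ring

theorem one_sub_le_norm_mobius_denom {a w : ℂ} (hw : ‖w‖ < 1) :
    1 - ‖a‖ ≤ ‖1 - (starRingEnd ℂ) a * w‖ := by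
  have h := norm_sub_norm_le (1 : ℂ) ((starRingEnd ℂ) a * w)
  simp only [norm_one, norm_mul, RCLike.norm_conj] at h
  nlinarith [norm_nonneg a, norm_nonneg w]

variable {q : ℂ → ℂ} {p : ℂ} {ρ : ℝ}

theorem mobius_comp_mapsTo (hq : DifferentiableOn ℂ q (ball p ρ))
    (hm : ∀ z ∈ ball p ρ, ‖q z‖ < 1) (hρ : 0 < ρ) :
    DifferentiableOn ℂ (fun z => (q z - q p) / (1 - (starRingEnd ℂ) (q p) * q z)) (ball p ρ) ∧
    MapsTo (fun z => (q z - q p) / (1 - (starRingEnd ℂ) (q p) * q z)) (ball p ρ)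
      (closedBall ((q p - q p) / (1 - (starRingEnd ℂ) (q p) * q p)) 1) := by
  have ha : ‖q p‖ < 1 := hm p (mem_ball_self hρ)
  have hpos : ∀ z ∈ ball p ρ, 0 < ‖1 - (starRingEnd ℂ) (q p) * q z‖ := fun z hz =>
    lt_of_lt_of_le (by linarith) (one_sub_le_norm_mobius_denom (a := q p) (hm z hz))
  refine ⟨(hq.sub_const _).div ((hq.const_mul _).const_sub _)
    fun z hz => norm_pos_iff.1 (hpos z hz), fun z hz => ?_⟩
  simp only [sub_self, zero_div, mem_closedBall, dist_zero_right, norm_div]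
  rw [div_le_one (hpos z hz)]
  have h1 := norm_sub_sq_mobius (q p) (q z)
  have h2 : 0 ≤ (1 - ‖q p‖ ^ 2) * (1 - ‖q z‖ ^ 2) := by
    have := hm z hz
    apply mul_nonneg <;> nlinarith [norm_nonneg (q p), norm_nonneg (q z)]
  exact abs_le_of_sq_le_sq' (by linarith) (norm_nonneg _) |>.2

/-- A self-map bound of Schwarz–Pick type: the distance to the unit circle decays at most
linearly. -/
theorem schwarz_pick_lower (hq : DifferentiableOn ℂ q (ball p ρ))
    (hm : ∀ z ∈ ball p ρ, ‖q z‖ < 1) {z : ℂ} (hz : z ∈ ball p ρ) :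
    (1 - ‖q p‖) * (1 - ‖z - p‖ / ρ) ≤ 4 * (1 - ‖q z‖) := by
  have hρ : 0 < ρ := nonempty_ball.1 ⟨z, hz⟩
  have ha : ‖q p‖ < 1 := hm p (mem_ball_self hρ)
  have hw := hm z hz
  obtain ⟨hd, hmaps⟩ := mobius_comp_mapsTo hq hm hρ
  have h := Complex.dist_le_div_mul_dist_of_mapsTo_ball hd hmaps hz
  have hden := one_sub_le_norm_mobius_denom (a := q p) hw
  have hpos : 0 < ‖1 - (starRingEnd ℂ) (q p) * q z‖ := lt_of_lt_of_le (by linarith) hden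
  rw [dist_eq_norm, dist_eq_norm, sub_self, zero_div, sub_zero, norm_div,
    div_le_iff₀ hpos, one_div_mul_eq_div] at h
  set t := ‖z - p‖ / ρ
  have ht0 : 0 ≤ t := by positivity
  have ht1 : t < 1 := by
    rw [div_lt_one hρ]
    simpa [dist_eq_norm] using hz
  have h1 := norm_sub_sq_mobius (q p) (q z)
  set d := ‖1 - (starRingEnd ℂ) (q p) * q z‖
  have h2 : ‖q z - q p‖ ^ 2 ≤ (t * d) ^ 2 := pow_le_pow_left₀ (norm_nonneg _) h 2
  have h3 : (1 - t ^ 2) * (1 - ‖q p‖) ^ 2 ≤ (1 - ‖q p‖ ^ 2) * (1 - ‖q z‖ ^ 2) := by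
    have : (1 - ‖q p‖) ^ 2 ≤ d ^ 2 := pow_le_pow_left₀ (by linarith) hden 2
    have h1t : 0 ≤ 1 - t ^ 2 := by nlinarith
    nlinarith [mul_le_mul_of_nonneg_left this h1t]
  have h4 : (1 - t ^ 2) * (1 - ‖q p‖) ≤ (1 + ‖q p‖) * (1 - ‖q z‖ ^ 2) := by
    have h5 : 0 < 1 - ‖q p‖ := by linarith
    refine le_of_mul_le_mul_left ?_ h5
    nlinarith
  have hnn := norm_nonneg (q p)
  have hnn' := norm_nonneg (q z)
  have h6 : (1 - ‖q p‖) * (1 - t) ≤ (1 - t ^ 2) * (1 - ‖q p‖) := by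
    rw [mul_comm]
    apply mul_le_mul_of_nonneg_right <;> nlinarith
  have h7 : (1 + ‖q p‖) * (1 - ‖q z‖ ^ 2) ≤ 2 * (1 - ‖q z‖ ^ 2) := by
    apply mul_le_mul_of_nonneg_right <;> nlinarith
  nlinarith

/-- The infinitesimal Schwarz–Pick inequality at the centre of a disc. -/
theorem schwarz_pick_deriv (hq : DifferentiableOn ℂ q (ball p ρ))
    (hm : ∀ z ∈ ball p ρ, ‖q z‖ < 1) (hρ : 0 < ρ) :
    ‖deriv q p‖ * ρ ≤ 2 * (1 - ‖q p‖) := by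
  have ha : ‖q p‖ < 1 := hm p (mem_ball_self hρ)
  obtain ⟨hd, hmaps⟩ := mobius_comp_mapsTo hq hm hρ
  have h := Complex.norm_deriv_le_div_of_mapsTo_ball hd hmaps hρ
  have hden : 1 - (starRingEnd ℂ) (q p) * q p = ((1 - ‖q p‖ ^ 2 : ℝ) : ℂ) := by
    rw [Complex.conj_mul']
    push_cast
    rfl
  have hpos : 0 < 1 - ‖q p‖ ^ 2 := by nlinarith [norm_nonneg (q p)]
  have hqd : HasDerivAt q (deriv q p) p :=
    (hq.differentiableAt (ball_mem_nhds p hρ)).hasDerivAt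
  have hD := (hqd.sub_const (q p)).div ((hqd.const_mul ((starRingEnd ℂ) (q p))).const_sub 1)
    (by rw [hden]; exact_mod_cast hpos.ne')
  have hD' := hD.deriv
  rw [show (fun z => (q z - q p) / (1 - (starRingEnd ℂ) (q p) * q z)) =
    ((fun x => q x - q p) / fun x => 1 - (starRingEnd ℂ) (q p) * q x) from rfl, hD',
    sub_self, zero_mul, sub_zero, hden, norm_div, norm_mul, norm_pow, Complex.norm_real,
    Real.norm_of_nonneg hpos.le, sq (1 - _), mul_div_mul_right _ _ hpos.ne',
    div_le_div_iff₀ hpos hρ] at h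
  nlinarith [norm_nonneg (q p)]

end SchwarzPick

section Poisson

instance isProbabilityMeasure_circleMeasure : IsProbabilityMeasure circleMeasure := by
  constructor
  have h : Measurable fun t : ℝ => Complex.exp (t * Complex.I) := by fun_prop
  have hpi : (0 : ℝ) < 2 * Real.pi := by positivity
  rw [circleMeasure, Measure.smul_apply, Measure.map_apply h MeasurableSet.univ, preimage_univ,
    Measure.restrict_apply_univ, Real.volume_Ioc, sub_zero, smul_eq_mul]
  exact ENNReal.inv_mul_cancel (by simpa using hpi) ENNReal.ofReal_ne_top

theorem ae_circleMeasure_norm : ∀ᵐ ζ ∂circleMeasure, ‖ζ‖ = 1 := by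
  refine Measure.ae_smul_measure ?_ _
  have hm : MeasurableSet {ζ : ℂ | ‖ζ‖ = 1} := measurableSet_eq_fun measurable_norm measurable_const
  rw [ae_map_iff (by fun_prop) hm]
  filter_upwards with t using Complex.norm_exp_ofReal_mul_I t

theorem aestronglyMeasurable_circleMeasure {E : Type*} [NormedAddCommGroup E]
    [SecondCountableTopology E] {f : ℂ → E} (hf : ContinuousOn f (sphere (0:ℂ) 1)) :
    AEStronglyMeasurable f circleMeasure := by
  have h : circleMeasure.restrict (sphere (0:ℂ) 1) = circleMeasure :=
    Measure.restrict_eq_self_of_ae_mem (by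
      filter_upwards [ae_circleMeasure_norm] with ζ hζ using by simpa using hζ)
  rw [← h]
  borelize E
  exact hf.aestronglyMeasurable isClosed_sphere.measurableSet

theorem integral_circleMeasure {E : Type*} [NormedAddCommGroup E] [NormedSpace ℝ E]
    {f : ℂ → E} (hf : AEStronglyMeasurable f circleMeasure) :
    ∫ ζ, f ζ ∂circleMeasure = Real.circleAverage f 0 1 := by
  have hpi : (0 : ℝ) < 2 * Real.pi := by positivity
  have hc : (ENNReal.ofReal (2 * Real.pi))⁻¹ ≠ 0 := ENNReal.inv_ne_zero.2 ENNReal.ofReal_ne_top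
  have hf' : AEStronglyMeasurable f (Measure.map (fun t : ℝ => Complex.exp (t * Complex.I))
      (volume.restrict (Ioc (0:ℝ) (2 * Real.pi)))) :=
    hf.mono_ac (Measure.AbsolutelyContinuous.rfl.smul_right hc)
  rw [circleMeasure, integral_smul_measure, integral_map (by fun_prop) hf', Real.circleAverage_def,
    intervalIntegral.integral_of_le hpi.le, ENNReal.toReal_inv, ENNReal.toReal_ofReal hpi.le]
  simp [circleMap]

theorem measurable_poisson_density (z : ℂ) :
    Measurable fun ζ : ℂ => ENNReal.ofReal ((1 - ‖z‖ ^ 2) / ‖ζ - z‖ ^ 2) := by fun_prop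

theorem integral_poissonMeasure {E : Type*} [NormedAddCommGroup E] [NormedSpace ℝ E] {z : ℂ}
    (hz : z ∈ ball (0:ℂ) 1) (f : ℂ → E) :
    ∫ ζ, f ζ ∂poissonMeasure z = ∫ ζ, ((1 - ‖z‖ ^ 2) / ‖ζ - z‖ ^ 2) • f ζ ∂circleMeasure := by
  rw [poissonMeasure, integral_withDensity_eq_integral_toReal_smul (measurable_poisson_density z)
    (by simp)]
  congr with ζ
  have : ‖z‖ < 1 := by simpa using hz
  rw [ENNReal.toReal_ofReal]
  have := norm_nonneg z
  apply div_nonneg <;> nlinarith [norm_nonneg (ζ - z)]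

theorem integrable_poissonMeasure_iff {E : Type*} [NormedAddCommGroup E] [NormedSpace ℝ E] {z : ℂ}
    (hz : z ∈ ball (0:ℂ) 1) {f : ℂ → E} :
    Integrable f (poissonMeasure z) ↔
      Integrable (fun ζ => ((1 - ‖z‖ ^ 2) / ‖ζ - z‖ ^ 2) • f ζ) circleMeasure := by
  rw [poissonMeasure, integrable_withDensity_iff_integrable_smul' (measurable_poisson_density z)
    (by simp)]
  congr! with ζ
  have : ‖z‖ < 1 := by simpa using hz
  rw [ENNReal.toReal_ofReal]
  have := norm_nonneg z
  apply div_nonneg <;> nlinarith [norm_nonneg (ζ - z)]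

theorem poissonMeasure_absolutelyContinuous (z : ℂ) : poissonMeasure z ≪ circleMeasure :=
  withDensity_absolutelyContinuous _ _

theorem norm_one_sub_le {z ζ : ℂ} (hζ : ‖ζ‖ = 1) : 1 - ‖z‖ ≤ ‖ζ - z‖ := by
  simpa [hζ] using norm_sub_norm_le ζ z

theorem poisson_density_le {z ζ : ℂ} (hz : ‖z‖ < 1) (hζ : ‖ζ‖ = 1) :
    (1 - ‖z‖ ^ 2) / ‖ζ - z‖ ^ 2 ≤ 2 / (1 - ‖z‖) := by
  have h := norm_one_sub_le (z := z) hζ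
  have h1 : 0 < 1 - ‖z‖ := by linarith
  rw [div_le_div_iff₀ (by have := h1.trans_le h; positivity) h1]
  have h2 : (1 - ‖z‖) ^ 2 ≤ ‖ζ - z‖ ^ 2 := pow_le_pow_left₀ h1.le h 2
  nlinarith [norm_nonneg z]

theorem integrable_poissonMeasure_iff_circleMeasure {z : ℂ} (hz : z ∈ ball (0:ℂ) 1) {f : ℂ → ℝ} :
    Integrable f (poissonMeasure z) ↔ Integrable f circleMeasure := by
  have hz' : ‖z‖ < 1 := by simpa using hz
  have hnn := norm_nonneg z
  have hpos : 0 < 1 - ‖z‖ ^ 2 := by nlinarith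
  rw [integrable_poissonMeasure_iff hz]
  simp only [smul_eq_mul]
  constructor
  · intro h
    have h2 := h.bdd_mul (f := fun ζ => ‖ζ - z‖ ^ 2 / (1 - ‖z‖ ^ 2)) (c := 4 / (1 - ‖z‖ ^ 2))
      (by fun_prop) (by
        filter_upwards [ae_circleMeasure_norm] with ζ hζ
        rw [Real.norm_of_nonneg (by positivity)]
        gcongr
        have : ‖ζ - z‖ ≤ 2 := (norm_sub_le _ _).trans (by linarith)
        nlinarith [norm_nonneg (ζ - z)])
    refine h2.congr ?_
    filter_upwards [ae_circleMeasure_norm] with ζ hζ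
    have : 0 < ‖ζ - z‖ := lt_of_lt_of_le (by linarith) (norm_one_sub_le hζ)
    field_simp
  · intro h
    refine h.bdd_mul (c := 2 / (1 - ‖z‖))
      (Measurable.aestronglyMeasurable (by fun_prop)) ?_
    filter_upwards [ae_circleMeasure_norm] with ζ hζ
    rw [Real.norm_of_nonneg (by positivity)]
    exact poisson_density_le hz' hζ

/-- The Poisson formula for functions holomorphic on a larger disc, in terms of dilations. -/
theorem integral_poissonMeasure_dilate {g : ℂ → ℂ} (hg : DifferentiableOn ℂ g (ball 0 1))
    {r : ℝ} (hr0 : 0 ≤ r) (hr1 : r < 1) {z : ℂ} (hz : z ∈ ball (0:ℂ) 1) :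
    ∫ ζ, g (r * ζ) ∂poissonMeasure z = g (r * z) := by
  have hmaps : MapsTo (fun ζ : ℂ => (r : ℂ) * ζ) (closedBall 0 1) (ball 0 1) := by
    intro ζ hζ
    simp only [mem_closedBall, dist_zero_right, mem_ball, norm_mul, Complex.norm_real,
      Real.norm_of_nonneg hr0] at hζ ⊢
    nlinarith [norm_nonneg ζ]
  have hcont : ContinuousOn (fun ζ : ℂ => g (r * ζ)) (closedBall 0 1) :=
    hg.continuousOn.comp (by fun_prop) hmaps
  have hdiff : DiffContOnCl ℂ (fun ζ : ℂ => g (r * ζ)) (ball 0 1) := by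
    refine ⟨hg.comp (by fun_prop) (hmaps.mono_left ball_subset_closedBall), ?_⟩
    rwa [closure_ball _ one_ne_zero]
  have h := hdiff.circleAverage_poissonKernel_smul hz
  rw [integral_poissonMeasure hz, integral_circleMeasure, ← h]
  · refine Real.circleAverage_congr_sphere fun ζ hζ => ?_
    have : ‖ζ‖ = 1 := by simpa using hζ
    simp [poissonKernel, this]
  · have hP : ContinuousOn (fun ζ : ℂ => (1 - ‖z‖ ^ 2) / ‖ζ - z‖ ^ 2) (sphere 0 1) := by
      refine ContinuousOn.div (by fun_prop) (by fun_prop) fun ζ hζ => ?_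
      have h1 := norm_one_sub_le (z := z) (show ‖ζ‖ = 1 by simpa using hζ)
      have : 0 < ‖ζ - z‖ := lt_of_lt_of_le (by simpa using hz) h1
      positivity
    exact aestronglyMeasurable_circleMeasure (hP.smul (hcont.mono sphere_subset_closedBall))

theorem isProbabilityMeasure_poissonMeasure {z : ℂ} (hz : z ∈ ball (0:ℂ) 1) :
    IsProbabilityMeasure (poissonMeasure z) := by
  have hfin : IsFiniteMeasure (poissonMeasure z) := by
    have h := (integrable_poissonMeasure_iff_circleMeasure hz (f := fun _ => 1)).2
      (integrable_const _)
    rcases integrable_const_iff.1 h with h | h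
    · simp at h
    · exact h
  have h := integral_poissonMeasure_dilate (g := fun _ => 1) (differentiableOn_const _) le_rfl
    zero_lt_one hz
  rw [integral_const, Complex.real_smul, mul_one, Complex.ofReal_eq_one] at h
  constructor
  rwa [measureReal_def, ENNReal.toReal_eq_one_iff] at h

/-- Bounded real parts of holomorphic functions are Poisson integrals of their radial limits. -/
theorem re_eq_integral_of_radial_limit {H : ℂ → ℂ} (hH : DifferentiableOn ℂ H (ball 0 1)) {C : ℝ}
    (hC : ∀ z ∈ ball (0:ℂ) 1, |(H z).re| ≤ C) {V : ℂ → ℝ}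
    (hV : ∀ᵐ ζ ∂circleMeasure, Tendsto (fun r : ℝ => (H (r * ζ)).re) (𝓝[<] 1) (𝓝 (V ζ)))
    {z : ℂ} (hz : z ∈ ball (0:ℂ) 1) :
    (H z).re = ∫ ζ, V ζ ∂poissonMeasure z := by
  have hprob := isProbabilityMeasure_poissonMeasure hz
  have hev : ∀ᶠ r : ℝ in 𝓝[<] 1, 0 ≤ r ∧ r < 1 :=
    (eventually_nhdsWithin_of_eventually_nhds (eventually_ge_nhds zero_lt_one)).and
      self_mem_nhdsWithin
  have hmem : ∀ {r : ℝ} {ζ : ℂ}, 0 ≤ r → r < 1 → ‖ζ‖ ≤ 1 → (r : ℂ) * ζ ∈ ball (0:ℂ) 1 := by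
    intro r ζ h0 h1 hζ
    simp only [mem_ball, dist_zero_right, norm_mul, Complex.norm_real, Real.norm_of_nonneg h0]
    nlinarith [norm_nonneg ζ]
  have hcont : ∀ r : ℝ, 0 ≤ r → r < 1 →
      ContinuousOn (fun ζ : ℂ => H (r * ζ)) (sphere 0 1) := fun r h0 h1 =>
    hH.continuousOn.comp (by fun_prop) fun ζ hζ => hmem h0 h1 (le_of_eq (by simpa using hζ))
  have hInteg : ∀ r : ℝ, 0 ≤ r → r < 1 →
      ∫ ζ, (H (r * ζ)).re ∂poissonMeasure z = (H (r * z)).re := by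
    intro r h0 h1
    rw [← integral_poissonMeasure_dilate hH h0 h1 hz]
    refine integral_re (𝕜 := ℂ) ?_
    have hcpt : IsCompact ((fun ζ : ℂ => H (r * ζ)) '' sphere 0 1) :=
      (isCompact_sphere _ _).image_of_continuousOn (hcont r h0 h1)
    obtain ⟨M, hM⟩ := hcpt.isBounded.exists_norm_le
    refine Integrable.of_bound ((aestronglyMeasurable_circleMeasure (hcont r h0 h1)).mono_ac
      (poissonMeasure_absolutelyContinuous z)) M ?_
    filter_upwards [(poissonMeasure_absolutelyContinuous z).ae_le ae_circleMeasure_norm] with ζ hζ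
    exact hM _ ⟨ζ, by simpa using hζ, rfl⟩
  have hlim : Tendsto (fun r : ℝ => ∫ ζ, (H (r * ζ)).re ∂poissonMeasure z) (𝓝[<] 1)
      (𝓝 (∫ ζ, V ζ ∂poissonMeasure z)) := by
    refine tendsto_integral_filter_of_dominated_convergence (fun _ => C) ?_ ?_
      (integrable_const _) ((poissonMeasure_absolutelyContinuous z).ae_le hV)
    · filter_upwards [hev] with r hr
      exact (aestronglyMeasurable_circleMeasure (Complex.continuous_re.comp_continuousOn
        (hcont r hr.1 hr.2))).mono_ac (poissonMeasure_absolutelyContinuous z)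
    · filter_upwards [hev] with r hr
      filter_upwards [(poissonMeasure_absolutelyContinuous z).ae_le ae_circleMeasure_norm]
        with ζ hζ
      exact hC _ (hmem hr.1 hr.2 hζ.le)
  have hlim2 : Tendsto (fun r : ℝ => (H (r * z)).re) (𝓝[<] 1) (𝓝 (H z).re) := by
    have h1 : ContinuousAt H ((1 : ℝ) * z) := by
      rw [Complex.ofReal_one, one_mul]
      exact hH.continuousOn.continuousAt (isOpen_ball.mem_nhds hz)
    have h2 : ContinuousAt (fun r : ℝ => (H (r * z)).re) 1 :=
      Complex.continuous_re.continuousAt.comp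
        (ContinuousAt.comp (f := fun r : ℝ => (r : ℂ) * z) h1 (by fun_prop))
    have := h2.tendsto.mono_left (nhdsWithin_le_nhds (s := Iio 1))
    simpa using this
  refine tendsto_nhds_unique hlim2 (hlim.congr' ?_)
  filter_upwards [hev] with r hr using hInteg r hr.1 hr.2

/-- A bounded holomorphic function on the disc with vanishing radial limits is zero. -/
theorem eq_zero_of_radial_limit {Φ : ℂ → ℂ} (hΦ : DifferentiableOn ℂ Φ (ball 0 1)) {C : ℝ}
    (hC : ∀ z ∈ ball (0:ℂ) 1, ‖Φ z‖ ≤ C)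
    (h0 : ∀ᵐ ζ ∂circleMeasure, Tendsto (fun r : ℝ => Φ (r * ζ)) (𝓝[<] 1) (𝓝 0))
    {z : ℂ} (hz : z ∈ ball (0:ℂ) 1) : Φ z = 0 := by
  have h1 := re_eq_integral_of_radial_limit hΦ (fun w hw => (Complex.abs_re_le_norm _).trans
    (hC w hw)) (V := fun _ => 0) (by
      filter_upwards [h0] with ζ hζ
      simpa [Function.comp_def] using (Complex.continuous_re.tendsto _).comp hζ) hz
  have h2 := re_eq_integral_of_radial_limit (hΦ.const_mul I) (C := C) (fun w hw =>
    (Complex.abs_re_le_norm _).trans (by simpa using hC w hw)) (V := fun _ => 0) (by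
      filter_upwards [h0] with ζ hζ
      simpa [Function.comp_def] using (Complex.continuous_im.tendsto _).comp hζ.neg) hz
  simp only [integral_zero] at h1 h2
  apply Complex.ext
  · simpa using h1
  · simpa using h2

/-- Poisson integrals are real parts of holomorphic functions. -/
theorem exists_holomorphic_re_eq_integral {k : ℂ → ℝ} (hk : Integrable k circleMeasure) :
    ∃ H : ℂ → ℂ, DifferentiableOn ℂ H (ball 0 1) ∧
      ∀ z ∈ ball (0:ℂ) 1, (H z).re = ∫ ζ, k ζ ∂poissonMeasure z := by
  have hkc : Integrable (fun ζ => (k ζ : ℂ)) circleMeasure := hk.ofReal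
  have hbd : ∀ {z ζ : ℂ}, ‖z‖ < 1 → ‖ζ‖ = 1 → ‖(ζ + z) / (ζ - z)‖ ≤ 2 / (1 - ‖z‖) := by
    intro z ζ hz hζ
    rw [norm_div]
    have := norm_one_sub_le (z := z) hζ
    have h2 : ‖ζ + z‖ ≤ 2 := (norm_add_le _ _).trans (by linarith)
    have h3 : 0 < 1 - ‖z‖ := by linarith
    gcongr
  have hInteg : ∀ z : ℂ, ‖z‖ < 1 →
      Integrable (fun ζ => (ζ + z) / (ζ - z) * (k ζ : ℂ)) circleMeasure := fun z hz =>
    hkc.bdd_mul (Measurable.aestronglyMeasurable (by fun_prop)) (by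
      filter_upwards [ae_circleMeasure_norm] with ζ hζ using hbd hz hζ)
  refine ⟨fun z => ∫ ζ, (ζ + z) / (ζ - z) * (k ζ : ℂ) ∂circleMeasure, ?_, ?_⟩
  · intro z hz
    have hz' : ‖z‖ < 1 := by simpa using hz
    set ε := (1 - ‖z‖) / 2 with hε
    have hε0 : 0 < ε := by rw [hε]; linarith
    have hs : ∀ x ∈ ball z ε, ‖x‖ ≤ 1 - ε := by
      intro x hx
      have h1 : ‖x - z‖ < ε := by simpa [dist_eq_norm] using hx
      have h2 : ‖x‖ ≤ ‖z‖ + ‖x - z‖ := by simpa using norm_add_le z (x - z)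
      rw [hε] at *; linarith
    refine (hasDerivAt_integral_of_dominated_loc_of_deriv_le (ball_mem_nhds z hε0)
      (F' := fun x ζ => 2 * ζ / (ζ - x) ^ 2 * (k ζ : ℂ))
      (bound := fun ζ => 2 / ε ^ 2 * ‖k ζ‖) ?_ (hInteg z hz') ?_ ?_
      (hk.norm.const_mul _) ?_).2.differentiableAt.differentiableWithinAt
    · filter_upwards [ball_mem_nhds z hε0] with x hx
      exact (hInteg x ((hs x hx).trans_lt (by linarith))).aestronglyMeasurable
    · exact AEStronglyMeasurable.mul (Measurable.aestronglyMeasurable (by fun_prop))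
        hkc.aestronglyMeasurable
    · filter_upwards [ae_circleMeasure_norm] with ζ hζ x hx
      have h1 := norm_one_sub_le (z := x) hζ
      have h2 := hs x hx
      rw [norm_mul, norm_div, norm_mul, norm_pow, hζ, Complex.norm_real]
      simp only [Complex.norm_ofNat, mul_one]
      gcongr
      linarith
    · filter_upwards [ae_circleMeasure_norm] with ζ hζ x hx
      have h1 := norm_one_sub_le (z := x) hζ
      have h2 := hs x hx
      have h3 : ζ - x ≠ 0 := norm_pos_iff.1 (by linarith)
      refine HasDerivAt.mul_const ?_ _
      have := ((hasDerivAt_id x).const_add ζ).div ((hasDerivAt_id x).const_sub ζ) h3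
      refine this.congr_deriv ?_
      simp only [id]
      ring
  · intro z hz
    have hz' : ‖z‖ < 1 := by simpa using hz
    rw [integral_poissonMeasure hz]
    refine (integral_re (𝕜 := ℂ) (hInteg z hz')).symm.trans (integral_congr_ae ?_)
    filter_upwards [ae_circleMeasure_norm] with ζ hζ
    have := congrFun (poissonKernel_eq_re_herglotzRieszKernel (c := 0) (w := z)) ζ
    simp only [poissonKernel, herglotzRieszKernel, Function.comp, sub_zero, hζ, one_pow] at this
    simp only [RCLike.re_to_complex, Complex.re_mul_ofReal, smul_eq_mul]
    rw [this]

theorem infDist_compl_ball {z : ℂ} (hz : z ∈ ball (0:ℂ) 1) :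
    infDist z (ball (0:ℂ) 1)ᶜ = 1 - ‖z‖ := by
  have hz' : ‖z‖ < 1 := by simpa using hz
  have hne : ((ball (0:ℂ) 1)ᶜ).Nonempty := ⟨1, by simp⟩
  apply le_antisymm
  · obtain ⟨u, hu, hzu⟩ : ∃ u : ℂ, ‖u‖ = 1 ∧ z = ‖z‖ * u := by
      refine ⟨Complex.exp (z.arg * I), Complex.norm_exp_ofReal_mul_I _, ?_⟩
      exact (Complex.norm_mul_exp_arg_mul_I z).symm
    refine (infDist_le_dist_of_mem (y := u) (by simp [hu])).trans_eq ?_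
    rw [dist_comm, dist_eq_norm]
    have h2 : u - z = ((1 - ‖z‖ : ℝ) : ℂ) * u := by
      conv_lhs => rw [hzu]
      push_cast; ring
    rw [h2, norm_mul, hu, mul_one, Complex.norm_real, Real.norm_of_nonneg (by linarith)]
  · refine (le_infDist hne).2 fun y hy => ?_
    have : 1 ≤ ‖y‖ := by simpa using hy
    rw [dist_comm, dist_eq_norm]
    exact (by linarith : 1 - ‖z‖ ≤ ‖y‖ - ‖z‖).trans (norm_sub_norm_le _ _)

theorem NTLim.radial {g : ℂ → ℂ} {ζ L : ℂ} (h : NTLim (ball 0 1) g ζ L) (hζ : ‖ζ‖ = 1) :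
    Tendsto (fun r : ℝ => g (r * ζ)) (𝓝[<] 1) (𝓝 L) := by
  refine (h 2 one_lt_two).comp (tendsto_nhdsWithin_iff.2 ⟨?_, ?_⟩)
  · have : ContinuousAt (fun r : ℝ => (r : ℂ) * ζ) 1 := by fun_prop
    have := this.tendsto.mono_left (nhdsWithin_le_nhds (s := Iio 1))
    simpa using this
  · filter_upwards [eventually_nhdsWithin_of_eventually_nhds (eventually_gt_nhds zero_lt_one),
      self_mem_nhdsWithin] with r h0 h1
    have h1' : r < 1 := h1
    have hn : ‖(r : ℂ) * ζ‖ = r := by simp [hζ, abs_of_pos h0]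
    have hb : (r : ℂ) * ζ ∈ ball (0:ℂ) 1 := by rwa [mem_ball, dist_zero_right, hn]
    refine ⟨hb, ?_⟩
    rw [infDist_compl_ball hb, hn]
    have : (r : ℂ) * ζ - ζ = ((r - 1 : ℝ) : ℂ) * ζ := by push_cast; ring
    rw [this, norm_mul, hζ, Complex.norm_real, Real.norm_of_nonpos (by linarith)]
    linarith

end Poisson

section Winding

/-- `2πi` times the winding number about `a` of the image under `γ` of the circle of radius `r`. -/
def contourIndex (γ : ℂ → ℂ) (r : ℝ) (a : ℂ) : ℂ :=
  ∮ s in C(0, r), deriv γ s / (γ s - a)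

variable {γ : ℂ → ℂ} {U : Set ℂ}

theorem continuousOn_deriv_div_sub (hU : IsOpen U) (hγ : DifferentiableOn ℂ γ U) {S : Set ℂ}
    (hS : S ⊆ U) {a : ℂ} (ha : ∀ s ∈ S, γ s ≠ a) :
    ContinuousOn (fun s => deriv γ s / (γ s - a)) S :=
  ((hγ.deriv hU).continuousOn.mono hS).div ((hγ.continuousOn.mono hS).sub continuousOn_const)
    fun s hs => sub_ne_zero.2 (ha s hs)

theorem contourIndex_eq_of_norm_lt (hU : IsOpen U) (hγ : DifferentiableOn ℂ γ U) {r : ℝ}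
    (hr : 0 ≤ r) (hrU : sphere 0 r ⊆ U) {a b : ℂ}
    (hab : ∀ s ∈ sphere (0:ℂ) r, ‖a - b‖ < ‖γ s - b‖) :
    contourIndex γ r a = contourIndex γ r b := by
  have hb : ∀ s ∈ sphere (0:ℂ) r, γ s ≠ b := fun s hs h => by
    have := hab s hs
    rw [h, sub_self, norm_zero] at this
    exact absurd this (norm_nonneg _).not_gt
  have ha : ∀ s ∈ sphere (0:ℂ) r, γ s ≠ a := fun s hs h => by
    have := hab s hs
    rw [h] at this
    exact lt_irrefl _ this
  rw [contourIndex, contourIndex, ← sub_eq_zero, ← circleIntegral.integral_sub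
    ((continuousOn_deriv_div_sub hU hγ hrU ha).circleIntegrable hr)
    ((continuousOn_deriv_div_sub hU hγ hrU hb).circleIntegrable hr)]
  refine circleIntegral.integral_eq_zero_of_hasDerivWithinAt hr
    (f := fun s => log ((γ s - a) / (γ s - b))) fun s hs => ?_
  have h1 : HasDerivAt γ (deriv γ s) s :=
    (hγ.differentiableAt (hU.mem_nhds (hrU hs))).hasDerivAt
  have hb' : γ s - b ≠ 0 := sub_ne_zero.2 (hb s hs)
  have ha' : γ s - a ≠ 0 := sub_ne_zero.2 (ha s hs)
  have hslit : (γ s - a) / (γ s - b) ∈ slitPlane := by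
    have : (γ s - a) / (γ s - b) = 1 + (b - a) / (γ s - b) := by
      field_simp
      ring
    rw [this]
    apply mem_slitPlane_of_norm_lt_one
    rw [norm_div, div_lt_one (norm_pos_iff.2 hb'), norm_sub_rev]
    exact hab s hs
  refine HasDerivAt.hasDerivWithinAt ?_
  refine (((h1.sub_const a).div (h1.sub_const b) hb').clog hslit).congr_deriv ?_
  simp only [Pi.div_apply]
  field_simp

theorem contourIndex_eq_of_isPreconnected (hU : IsOpen U) (hγ : DifferentiableOn ℂ γ U)
    {r : ℝ} (hr : 0 ≤ r) (hrU : sphere 0 r ⊆ U) {Ω : Set ℂ} (hΩ : IsPreconnected Ω)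
    (hd : ∀ s ∈ sphere (0:ℂ) r, γ s ∉ Ω) {a b : ℂ} (ha : a ∈ Ω) (hb : b ∈ Ω) :
    contourIndex γ r a = contourIndex γ r b := by
  have : PreconnectedSpace Ω := isPreconnected_iff_preconnectedSpace.1 hΩ
  have hloc : IsLocallyConstant fun x : Ω => contourIndex γ r x := by
    rw [IsLocallyConstant.iff_eventually_eq]
    intro x
    have hcl : IsClosed (γ '' sphere 0 r) :=
      ((isCompact_sphere _ _).image_of_continuousOn (hγ.continuousOn.mono hrU)).isClosed
    have hx : (x : ℂ) ∈ (γ '' sphere 0 r)ᶜ := by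
      rintro ⟨s, hs, hsx⟩
      exact hd s hs (hsx ▸ x.2)
    obtain ⟨ε, hε, hball⟩ := Metric.isOpen_iff.1 hcl.isOpen_compl _ hx
    have hnear : ∀ᶠ y : Ω in 𝓝 x, (y : ℂ) ∈ ball (x : ℂ) ε :=
      continuous_subtype_val.continuousAt (ball_mem_nhds _ hε)
    filter_upwards [hnear] with y hy
    refine contourIndex_eq_of_norm_lt hU hγ hr hrU fun s hs => ?_
    have h1 : ‖(y : ℂ) - x‖ < ε := by simpa [dist_eq_norm] using hy
    refine h1.trans_le (not_lt.1 fun h => hball (a := γ s) ?_ ⟨s, hs, rfl⟩)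
    simpa [dist_eq_norm] using h
  exact hloc.apply_eq_of_preconnectedSpace ⟨a, ha⟩ ⟨b, hb⟩

theorem deriv_div_sub_eq (hU : IsOpen U) (hγ : DifferentiableOn ℂ γ U) (hinj : InjOn γ U)
    {q s : ℂ} (hq : q ∈ U) (hs : s ∈ U) (hsq : s ≠ q) :
    deriv γ s / (γ s - γ q) = (s - q)⁻¹ + deriv (dslope γ q) s / dslope γ q s := by
  have hsq' : s - q ≠ 0 := sub_ne_zero.2 hsq
  have hfac : ∀ x, γ x = γ q + (x - q) * dslope γ q x := fun x => by
    rw [← smul_eq_mul, sub_smul_dslope]; ring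
  have hne : dslope γ q s ≠ 0 := fun h => by
    have := hfac s
    rw [h, mul_zero, add_zero] at this
    exact hsq (hinj hs hq this)
  have hd : DifferentiableAt ℂ (dslope γ q) s :=
    ((Complex.differentiableOn_dslope (hU.mem_nhds hq)).2 hγ).differentiableAt (hU.mem_nhds hs)
  have hderiv : HasDerivAt γ (dslope γ q s + (s - q) * deriv (dslope γ q) s) s := by
    have h := (((hasDerivAt_id s).sub_const q).mul hd.hasDerivAt).const_add (γ q)
    have h2 : γ = fun x => γ q + ((fun x => id x - q) * dslope γ q) x := funext hfac
    rw [h2]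
    refine h.congr_deriv ?_
    rw [← h2]
    simp
  rw [hderiv.deriv, hfac s, add_sub_cancel_left]
  field_simp

theorem contourIndex_eq_add (hU : IsOpen U) (hγ : DifferentiableOn ℂ γ U) (hinj : InjOn γ U)
    (hder : ∀ s ∈ U, deriv γ s ≠ 0) {r R : ℝ} (hr : 0 < r) (hrR : r ≤ R)
    (hA : closedBall 0 R \ ball 0 r ⊆ U) {q : ℂ} (hq : q ∈ U) (hqr : ‖q‖ ≠ r) (hqR : ‖q‖ ≠ R) :
    contourIndex γ r (γ q) - (∮ s in C(0, r), (s - q)⁻¹) =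
      contourIndex γ R (γ q) - ∮ s in C(0, R), (s - q)⁻¹ := by
  have hds : DifferentiableOn ℂ (dslope γ q) U :=
    (Complex.differentiableOn_dslope (hU.mem_nhds hq)).2 hγ
  have hne : ∀ s ∈ U, dslope γ q s ≠ 0 := by
    intro s hs h
    rcases eq_or_ne s q with rfl | hsq
    · rw [dslope_same] at h
      exact hder s hs h
    · have := sub_smul_dslope γ q s
      rw [h, smul_zero, eq_comm, sub_eq_zero] at this
      exact hsq (hinj hs hq this)
  have hF : DifferentiableOn ℂ (fun s => deriv (dslope γ q) s / dslope γ q s) U :=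
    (hds.deriv hU).div hds hne
  have hInteg := Complex.circleIntegral_eq_of_differentiable_on_annulus_off_countable hr hrR
    countable_empty (hF.continuousOn.mono hA) (fun z hz => hF.differentiableAt
      (hU.mem_nhds (hA ⟨ball_subset_closedBall hz.1.1, fun h => hz.1.2
        (ball_subset_closedBall h)⟩)))
  have hcirc : ∀ t : ℝ, 0 < t → sphere (0:ℂ) t ⊆ U → ‖q‖ ≠ t →
      contourIndex γ t (γ q) - (∮ s in C(0, t), (s - q)⁻¹) =
        ∮ s in C(0, t), deriv (dslope γ q) s / dslope γ q s := by
    intro t ht htU hqt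
    have hsq : ∀ s ∈ sphere (0:ℂ) t, s ≠ q := by
      rintro s hs rfl
      exact hqt (by simpa using hs)
    rw [contourIndex, ← circleIntegral.integral_sub]
    · refine circleIntegral.integral_congr ht.le fun s hs => ?_
      rw [deriv_div_sub_eq hU hγ hinj hq (htU hs) (hsq s hs), add_sub_cancel_left]
    · exact (continuousOn_deriv_div_sub hU hγ htU fun s hs h =>
        hsq s hs (hinj (htU hs) hq h)).circleIntegrable ht.le
    · refine ContinuousOn.circleIntegrable ht.le (ContinuousOn.inv₀ (by fun_prop) fun s hs =>
        sub_ne_zero.2 (hsq s hs))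
  have hrU : sphere (0:ℂ) r ⊆ U := fun s hs => hA ⟨by
    have : ‖s‖ = r := by simpa using hs
    simpa [this] using hrR, by
    have : ‖s‖ = r := by simpa using hs
    simp [this]⟩
  have hRU : sphere (0:ℂ) R ⊆ U := fun s hs => hA ⟨sphere_subset_closedBall hs, by
    have : ‖s‖ = R := by simpa using hs
    simpa [this] using hrR⟩
  rw [hcirc r hr hrU hqr, hcirc R (hr.trans_le hrR) hRU hqR, hInteg]

/-- A connected set avoiding an analytic Jordan curve does not lie on both sides of it. -/
theorem exists_not_mem_both_sides (hU : IsOpen U) (hγ : DifferentiableOn ℂ γ U)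
    (hinj : InjOn γ U) (hder : ∀ s ∈ U, deriv γ s ≠ 0) (hsU : sphere 0 1 ⊆ U)
    {Ω : Set ℂ} (hΩ : IsPreconnected Ω) (hd : ∀ s ∈ sphere (0:ℂ) 1, γ s ∉ Ω)
    {p : ℂ} (hp : ‖p‖ = 1) :
    ∃ ε > 0, ∀ q₁ q₂ : ℂ, ‖q₁ - p‖ < ε → ‖q₂ - p‖ < ε → ‖q₁‖ < 1 → 1 < ‖q₂‖ →
      γ q₁ ∈ Ω → γ q₂ ∉ Ω := by
  obtain ⟨η, hη, hthick⟩ := (isCompact_sphere (0:ℂ) 1).exists_thickening_subset_open hU hsU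
  set R : ℝ := 1 + η / 2 with hR
  have hA : closedBall (0:ℂ) R \ ball 0 1 ⊆ U := by
    rintro s ⟨hs1, hs2⟩
    have h1 : ‖s‖ ≤ R := by simpa using hs1
    have h2 : 1 ≤ ‖s‖ := by simpa using hs2
    refine hthick (mem_thickening_iff.2 ⟨s / ‖s‖, ?_, ?_⟩)
    · have : s ≠ 0 := norm_pos_iff.1 (by linarith)
      simp [this]
    · rw [dist_eq_norm]
      have h3 : s - s / ‖s‖ = ((‖s‖ - 1 : ℝ) : ℂ) * (s / ‖s‖) := by
        have : (‖s‖ : ℂ) ≠ 0 := by exact_mod_cast (by linarith : ‖s‖ ≠ 0)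
        push_cast
        field_simp
      have h4 : ‖s / (‖s‖ : ℂ)‖ = 1 := by
        rw [norm_div, Complex.norm_real, norm_norm, div_self (by linarith)]
      rw [h3, norm_mul, h4, mul_one, Complex.norm_real, Real.norm_of_nonneg (by linarith)]
      linarith
  have hRU : sphere (0:ℂ) R ⊆ U := fun s hs => hA ⟨sphere_subset_closedBall hs, by
    have : ‖s‖ = R := by simpa using hs
    simp only [mem_ball, dist_zero_right, this, hR]
    linarith⟩
  have hpU : p ∈ U := hsU (by simpa using hp)
  have hcl : IsClosed (γ '' sphere 0 R) :=
    ((isCompact_sphere _ _).image_of_continuousOn (hγ.continuousOn.mono hRU)).isClosed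
  have hpn : γ p ∈ (γ '' sphere 0 R)ᶜ := by
    rintro ⟨s, hs, hsp⟩
    have h1 := hinj (hRU hs) hpU hsp
    have : ‖s‖ = R := by simpa using hs
    rw [h1, hp] at this
    linarith
  obtain ⟨d, hd0, hball⟩ := Metric.isOpen_iff.1 hcl.isOpen_compl _ hpn
  have hcont : ContinuousAt γ p := (hγ.differentiableAt (hU.mem_nhds hpU)).continuousAt
  obtain ⟨ε, hε, hεs⟩ := Metric.mem_nhds_iff.1 (inter_mem (hU.mem_nhds hpU)
    (hcont.preimage_mem_nhds (ball_mem_nhds (γ p) (half_pos (half_pos hd0)))))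
  refine ⟨min ε (η / 2), lt_min hε (by positivity), fun q₁ q₂ h₁ h₂ hn₁ hn₂ hm₁ hm₂ => ?_⟩
  have hq₁ := hεs (a := q₁) (by simpa [dist_eq_norm] using h₁.trans_le (min_le_left _ _))
  have hq₂ := hεs (a := q₂) (by simpa [dist_eq_norm] using h₂.trans_le (min_le_left _ _))
  have hn₂R : ‖q₂‖ < R := by
    have h3 : ‖q₂‖ ≤ ‖p‖ + ‖q₂ - p‖ := by simpa using norm_add_le p (q₂ - p)
    have := h₂.trans_le (min_le_right _ _)
    rw [hR]; linarith
  have hR1 : 1 ≤ R := by rw [hR]; linarith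
  have e₁ := contourIndex_eq_add hU hγ hinj hder zero_lt_one hR1 hA hq₁.1 hn₁.ne
    (hn₁.trans_le hR1).ne
  have e₂ := contourIndex_eq_add hU hγ hinj hder zero_lt_one hR1 hA hq₂.1 hn₂.ne' hn₂R.ne
  have eΩ := contourIndex_eq_of_isPreconnected hU hγ zero_le_one hsU hΩ hd hm₁ hm₂
  have eR : contourIndex γ R (γ q₁) = contourIndex γ R (γ q₂) := by
    refine contourIndex_eq_of_norm_lt hU hγ (by linarith) hRU fun s hs => ?_
    have g₁ : ‖γ q₁ - γ p‖ < d / 2 / 2 := by simpa [dist_eq_norm] using hq₁.2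
    have g₂ : ‖γ q₂ - γ p‖ < d / 2 / 2 := by simpa [dist_eq_norm] using hq₂.2
    have g₃ : d ≤ ‖γ s - γ p‖ := not_lt.1 fun h => hball (a := γ s)
      (by simpa [dist_eq_norm] using h) ⟨s, hs, rfl⟩
    have g₄ := norm_sub_le_norm_sub_add_norm_sub (γ q₁) (γ p) (γ q₂)
    have g₅ := norm_sub_le_norm_sub_add_norm_sub (γ s) (γ q₂) (γ p)
    rw [norm_sub_rev (γ p)] at g₄
    linarith
  have i₁ : (∮ s in C(0, 1), (s - q₁)⁻¹) = 2 * Real.pi * I :=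
    circleIntegral.integral_sub_inv_of_mem_ball (by simpa using hn₁)
  have i₂ : (∮ s in C(0, 1), (s - q₂)⁻¹) = 0 := by
    refine DiffContOnCl.circleIntegral_eq_zero zero_le_one (DifferentiableOn.diffContOnCl ?_)
    rw [closure_ball _ one_ne_zero]
    refine DifferentiableOn.inv (by fun_prop) fun s hs => sub_ne_zero.2 ?_
    rintro rfl
    exact absurd (by simpa using hs) hn₂.not_ge
  have i₃ : (∮ s in C(0, R), (s - q₁)⁻¹) = 2 * Real.pi * I :=
    circleIntegral.integral_sub_inv_of_mem_ball (by simpa using hn₁.trans_le hR1)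
  have i₄ : (∮ s in C(0, R), (s - q₂)⁻¹) = 2 * Real.pi * I :=
    circleIntegral.integral_sub_inv_of_mem_ball (by simpa using hn₂R)
  rw [i₁, i₃] at e₁
  rw [i₂, i₄, ← eΩ, ← eR, ← e₁] at e₂
  have e₃ : contourIndex γ 1 (γ q₁) = contourIndex γ 1 (γ q₁) - 2 * Real.pi * I := by
    simpa using e₂
  exact two_pi_I_ne_zero (sub_eq_self.1 e₃.symm)

end Winding

section Chart

/-- A holomorphic chart straightening the boundary of `Ω` near `ζ₀`, with `Ω` on the left of the
imaginary axis. -/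
structure IsBoundaryChart (Ω : Set ℂ) (ζ₀ : ℂ) (κ : ℂ → ℂ) (δ : ℝ) : Prop where
  pos : 0 < δ
  diff : DifferentiableOn ℂ κ (ball 0 δ)
  inj : InjOn κ (ball 0 δ)
  zero : κ 0 = ζ₀
  mem_of_neg : ∀ x ∈ ball (0 : ℂ) δ, x.re < 0 → κ x ∈ Ω
  mem_frontier : ∀ x ∈ ball (0 : ℂ) δ, x.re = 0 → κ x ∈ frontier Ω
  notMem_of_pos : ∀ x ∈ ball (0 : ℂ) δ, 0 < x.re → κ x ∉ closure Ω

theorem IsAnalyticCurve.exists_isOpen {C : Set ℂ} (hC : IsAnalyticCurve C) :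
    ∃ γ : ℂ → ℂ, ∃ U : Set ℂ, IsOpen U ∧ sphere 0 1 ⊆ U ∧ DifferentiableOn ℂ γ U ∧
      InjOn γ U ∧ (∀ z ∈ U, deriv γ z ≠ 0) ∧ γ '' sphere 0 1 = C := by
  obtain ⟨γ, ha, hinj, him, hd⟩ := hC
  obtain ⟨t, ht, hti⟩ := hinj.exists_mem_nhdsSet (isCompact_sphere 0 1)
    (fun x hx => (ha x hx).continuousAt) fun x hx => by
      refine ⟨_, (ha x hx).hasStrictDerivAt.eventually_left_inverse (hd x hx), ?_⟩
      intro a h b h' hab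
      rw [← show _ = a from h, ← show _ = b from h', hab]
  obtain ⟨V, hVo, hsV, hVt⟩ := mem_nhdsSet_iff_exists.1 ht
  refine ⟨γ, V ∩ interior {z | AnalyticAt ℂ γ z ∧ deriv γ z ≠ 0}, hVo.inter isOpen_interior,
    fun z hz => ⟨hsV hz, ?_⟩, fun z hz => ?_, hti.mono (inter_subset_left.trans hVt),
    fun z hz => (interior_subset hz.2).2, him⟩
  · rw [mem_interior_iff_mem_nhds]
    exact (ha z hz).eventually_analyticAt.and
      ((ha z hz).deriv.continuousAt.eventually_ne (hd z hz))
  · exact (interior_subset hz.2).1.differentiableAt.differentiableWithinAt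

theorem subset_or_subset_of_disjoint_frontier {Ω S : Set ℂ} (hΩ : IsOpen Ω)
    (hS : IsPreconnected S) (hd : ∀ x ∈ S, x ∉ frontier Ω) : S ⊆ Ω ∨ S ⊆ (closure Ω)ᶜ := by
  refine IsPreconnected.subset_or_subset hΩ isClosed_closure.isOpen_compl
    (disjoint_compl_right.mono_left subset_closure |>.mono_right le_rfl) (fun x hx => ?_) hS
  by_cases h : x ∈ Ω
  · exact Or.inl h
  · refine Or.inr fun hc => hd x hx ?_
    rw [hΩ.frontier_eq]
    exact ⟨hc, h⟩

theorem MCDomain.exists_straightening (D : MCDomain n) {ζ₀ : ℂ} (hζ : ζ₀ ∈ frontier D.Ω) :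
    ∃ κ : ℂ → ℂ, ∃ δ > 0, DifferentiableOn ℂ κ (ball 0 δ) ∧ InjOn κ (ball 0 δ) ∧ κ 0 = ζ₀ ∧
      (∀ x ∈ ball (0 : ℂ) δ, κ x ∈ frontier D.Ω ↔ x.re = 0) ∧
      ∀ x ∈ ball (0 : ℂ) δ, ∀ y ∈ ball (0 : ℂ) δ, x.re < 0 → 0 < y.re →
        κ x ∈ D.Ω → κ y ∉ D.Ω := by
  have hζ' := hζ
  rw [D.frontier_eq] at hζ'
  obtain ⟨j, hj⟩ := mem_iUnion.1 hζ'
  obtain ⟨γ, U, hU, hsU, hγ, hinj, hder, him⟩ := (D.curve j).exists_isOpen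
  obtain ⟨p, hp, hpζ⟩ : ζ₀ ∈ γ '' sphere 0 1 := him ▸ hj
  have hp1 : ‖p‖ = 1 := by simpa using hp
  have hp0 : p ≠ 0 := norm_ne_zero_iff.1 (by rw [hp1]; exact one_ne_zero)
  have hcl : ∀ k, IsClosed (D.Γ k) := fun k => by
    obtain ⟨γ, U, hU, hsU, hγ, -, -, him⟩ := (D.curve k).exists_isOpen
    rw [← him]
    exact ((isCompact_sphere 0 1).image_of_continuousOn (hγ.continuousOn.mono hsU)).isClosed
  have hd : ∀ s ∈ sphere (0 : ℂ) 1, γ s ∉ D.Ω := fun s hs hm => by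
    have : γ s ∈ frontier D.Ω := by
      rw [D.frontier_eq]
      exact mem_iUnion.2 ⟨j, him ▸ mem_image_of_mem γ hs⟩
    rw [D.isOpen.frontier_eq] at this
    exact this.2 hm
  obtain ⟨ε, hε, hside⟩ := exists_not_mem_both_sides hU hγ hinj hder hsU
    D.conn.isPreconnected hd hp1
  have hE : Continuous fun x : ℂ => p * cexp x := by fun_prop
  have hE0 : p * cexp 0 = p := by simp
  have hnhd : ∀ V ∈ 𝓝 p, ∀ᶠ x in 𝓝 (0 : ℂ), p * cexp x ∈ V := fun V hV =>
    hE.continuousAt.eventually_mem (by rwa [hE0])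
  have hγp : ContinuousAt γ p := (hγ.differentiableAt (hU.mem_nhds (hsU hp))).continuousAt
  have hother : ∀ᶠ w in 𝓝 ζ₀, ∀ k, k ≠ j → w ∉ D.Γ k := by
    refine eventually_all.2 fun k => ?_
    by_cases hk : k = j
    · simp [hk]
    · filter_upwards [(hcl k).isOpen_compl.mem_nhds
        (disjoint_left.1 (D.disj j k (Ne.symm hk)) hj)] with w hw _ using hw
  have hgood : ∀ᶠ x in 𝓝 (0 : ℂ), p * cexp x ∈ U ∧ ‖p * cexp x - p‖ < ε ∧
      (∀ k, k ≠ j → γ (p * cexp x) ∉ D.Γ k) ∧ ‖x‖ < Real.pi := by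
    refine (hnhd U (hU.mem_nhds (hsU hp))).and ((?_ : ∀ᶠ _ in _, _).and ((?_ : ∀ᶠ _ in _, _).and ?_))
    · filter_upwards [hnhd _ (ball_mem_nhds p hε)] with x hx
      simpa [dist_eq_norm] using hx
    · exact hnhd _ (hγp.eventually (hpζ ▸ hother))
    · filter_upwards [ball_mem_nhds (0 : ℂ) Real.pi_pos] with x hx
      simpa using hx
  obtain ⟨δ, hδ, hb⟩ := Metric.eventually_nhds_iff_ball.1 hgood
  have hn : ∀ x : ℂ, ‖p * cexp x‖ = Real.exp x.re := fun x => by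
    rw [norm_mul, hp1, one_mul, norm_exp]
  refine ⟨fun x => γ (p * cexp x), δ, hδ, ?_, ?_, by simp [hpζ], fun x hx => ?_, ?_⟩
  · exact hγ.comp (by fun_prop) fun x hx => (hb x hx).1
  · intro x hx y hy hxy
    have h₁ := mul_left_cancel₀ hp0 (hinj (hb x hx).1 (hb y hy).1 hxy)
    have hx' := abs_lt.1 ((abs_im_le_norm x).trans_lt (hb x hx).2.2.2)
    have hy' := abs_lt.1 ((abs_im_le_norm y).trans_lt (hb y hy).2.2.2)
    exact exp_inj_of_neg_pi_lt_of_le_pi hx'.1 hx'.2.le hy'.1 hy'.2.le h₁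
  · rw [D.frontier_eq]
    constructor
    · intro h
      obtain ⟨k, hk⟩ := mem_iUnion.1 h
      have hkj : k = j := by_contra fun h => (hb x hx).2.2.1 k h hk
      rw [hkj, ← him] at hk
      obtain ⟨s, hs, hse⟩ := hk
      have := hinj (hsU hs) (hb x hx).1 hse
      have h1 : ‖s‖ = 1 := by simpa using hs
      rw [this, hn, Real.exp_eq_one_iff] at h1
      exact h1
    · intro h
      refine mem_iUnion.2 ⟨j, him ▸ mem_image_of_mem γ ?_⟩
      rw [mem_sphere_zero_iff_norm, hn, h, Real.exp_zero]
  · intro x hx y hy hxr hyr hxm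
    refine hside _ _ (hb x hx).2.1 (hb y hy).2.1 ?_ ?_ hxm
    · rw [hn]; simpa using hxr
    · rw [hn]; simpa using hyr

theorem MCDomain.exists_isBoundaryChart (D : MCDomain n) {ζ₀ : ℂ} (hζ : ζ₀ ∈ frontier D.Ω) :
    ∃ κ : ℂ → ℂ, ∃ δ, IsBoundaryChart D.Ω ζ₀ κ δ := by
  obtain ⟨κ, δ, hδ, hκ, hinj, h0, hfr, hside⟩ := D.exists_straightening hζ
  have hL : Convex ℝ (ball (0 : ℂ) δ ∩ {x | x.re < 0}) :=
    (convex_ball _ _).inter (convex_halfSpace_re_lt 0)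
  have hR : Convex ℝ (ball (0 : ℂ) δ ∩ {x | 0 < x.re}) :=
    (convex_ball _ _).inter (convex_halfSpace_re_gt 0)
  have dich : ∀ S : Set ℂ, Convex ℝ S → S ⊆ ball 0 δ → (∀ x ∈ S, x.re ≠ 0) →
      κ '' S ⊆ D.Ω ∨ κ '' S ⊆ (closure D.Ω)ᶜ := fun S hS hSb hS0 => by
    refine subset_or_subset_of_disjoint_frontier D.isOpen
      (hS.isPreconnected.image _ (hκ.continuousOn.mono hSb)) ?_
    rintro _ ⟨x, hx, rfl⟩ hf
    exact hS0 x hx ((hfr x (hSb hx)).1 hf)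
  have hLR : κ '' (ball (0 : ℂ) δ ∩ {x | x.re < 0}) ⊆ D.Ω ∨
      κ '' (ball (0 : ℂ) δ ∩ {x | 0 < x.re}) ⊆ D.Ω := by
    have hop : IsOpen (κ '' ball 0 δ) :=
      isOpen_image_of_injOn isOpen_ball hκ hinj isOpen_ball subset_rfl
    obtain ⟨w, ⟨x, hx, rfl⟩, hw⟩ := mem_closure_iff.1 hζ.1 _ hop
      ⟨0, mem_ball_self hδ, h0⟩
    rcases lt_trichotomy x.re 0 with h | h | h
    · refine Or.inl ((dich _ hL inter_subset_left fun x hx => ne_of_lt hx.2).resolve_right ?_)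
      exact fun hh => hh ⟨x, ⟨hx, h⟩, rfl⟩ (subset_closure hw)
    · have := (hfr x hx).2 h
      rw [D.isOpen.frontier_eq] at this
      exact absurd hw this.2
    · refine Or.inr ((dich _ hR inter_subset_left fun x hx => ne_of_gt hx.2).resolve_right ?_)
      exact fun hh => hh ⟨x, ⟨hx, h⟩, rfl⟩ (subset_closure hw)
  have hmL : ∃ x ∈ ball (0 : ℂ) δ, x.re < 0 :=
    ⟨((-(δ / 2) : ℝ) : ℂ), by simp [abs_of_pos hδ]; linarith, by simpa using hδ⟩
  have hmR : ∃ x ∈ ball (0 : ℂ) δ, 0 < x.re :=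
    ⟨((δ / 2 : ℝ) : ℂ), by simp [abs_of_pos hδ]; linarith, by simpa using hδ⟩
  rcases hLR with hΩ | hΩ
  · refine ⟨κ, δ, hδ, hκ, hinj, h0, fun x hx h => hΩ ⟨x, ⟨hx, h⟩, rfl⟩,
      fun x hx h => (hfr x hx).2 h, fun x hx h => ?_⟩
    obtain ⟨y, hy, hyr⟩ := hmL
    refine ((dich _ hR inter_subset_left fun x hx => ne_of_gt hx.2).resolve_left ?_)
      ⟨x, ⟨hx, h⟩, rfl⟩
    exact fun hh => hside y hy x hx hyr h (hΩ ⟨y, ⟨hy, hyr⟩, rfl⟩) (hh ⟨x, ⟨hx, h⟩, rfl⟩)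
  · have hneg : ∀ x ∈ ball (0 : ℂ) δ, -x ∈ ball (0 : ℂ) δ := fun x hx => by simpa using hx
    refine ⟨fun x => κ (-x), δ, hδ, hκ.comp (by fun_prop) hneg,
      fun x hx y hy h => neg_injective (hinj (hneg x hx) (hneg y hy) h), by simpa using h0,
      fun x hx h => hΩ ⟨-x, ⟨hneg x hx, by simpa using h⟩, rfl⟩,
      fun x hx h => (hfr _ (hneg x hx)).2 (by simpa using h), fun x hx h => ?_⟩
    obtain ⟨y, hy, hyr⟩ := hmR
    have hxr : (-x).re < 0 := by simpa using h
    refine ((dich _ hL inter_subset_left fun x hx => ne_of_lt hx.2).resolve_left ?_)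
      ⟨-x, ⟨hneg x hx, hxr⟩, rfl⟩
    exact fun hh => hside (-x) (hneg x hx) y hy hxr hyr (hh ⟨-x, ⟨hneg x hx, hxr⟩, rfl⟩)
      (hΩ ⟨y, ⟨hy, hyr⟩, rfl⟩)

end Chart

section ExteriorBall

theorem deriv_ne_zero_of_injOn {f : ℂ → ℂ} {U : Set ℂ} (hU : IsOpen U)
    (hf : DifferentiableOn ℂ f U) (hinj : InjOn f U) {z : ℂ} (hz : z ∈ U) : deriv f z ≠ 0 := by
  obtain ⟨t, ht, hinv⟩ := exists_holomorphic_inverse hU hf hinj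
  have ho := isOpen_image_of_injOn hU hf hinj hU subset_rfl
  have h₁ := (ht.differentiableAt (ho.mem_nhds ⟨z, hz, rfl⟩)).hasDerivAt.comp z
    (hf.differentiableAt (hU.mem_nhds hz)).hasDerivAt
  have h₂ : HasDerivAt (t ∘ f) 1 z := (hasDerivAt_id z).congr_of_eventuallyEq <| by
    filter_upwards [hU.mem_nhds hz] with x hx using hinv x hx
  intro h0
  have := h₁.unique h₂
  simp [h0] at this

theorem exists_quadratic_bound {κ : ℂ → ℂ} {δ r : ℝ} (hκ : DifferentiableOn ℂ κ (ball 0 δ))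
    (hr : r < δ) : ∃ K > 0, ∀ x ∈ closedBall (0 : ℂ) r, ∀ y ∈ closedBall (0 : ℂ) r,
      ‖κ x - κ y - deriv κ y * (x - y)‖ ≤ K * ‖x - y‖ ^ 2 := by
  have hsub : closedBall (0 : ℂ) r ⊆ ball 0 δ := closedBall_subset_ball hr
  have hκ' := hκ.deriv isOpen_ball
  have hκ'' := hκ'.deriv isOpen_ball
  obtain ⟨K, hK⟩ := (isCompact_closedBall (0 : ℂ) r).exists_bound_of_continuousOn
    (hκ''.continuousOn.mono hsub)
  have hd : ∀ f : ℂ → ℂ, DifferentiableOn ℂ f (ball 0 δ) → ∀ x ∈ closedBall (0 : ℂ) r,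
      DifferentiableAt ℂ f x := fun f hf x hx =>
    hf.differentiableAt (isOpen_ball.mem_nhds (hsub hx))
  refine ⟨max K 1, by positivity, fun x hx y hy => ?_⟩
  have hL : ∀ z ∈ closedBall (0 : ℂ) r, ‖deriv κ z - deriv κ y‖ ≤ max K 1 * ‖z - y‖ :=
    fun z hz => (convex_closedBall (0 : ℂ) r).norm_image_sub_le_of_norm_deriv_le (hd _ hκ')
      (fun z hz => (hK z hz).trans (le_max_left _ _)) hy hz
  have := ((convex_closedBall (0 : ℂ) r).inter
    (convex_closedBall y ‖x - y‖)).norm_image_sub_le_of_norm_deriv_le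
    (f := fun z => κ z - deriv κ y * z) (C := max K 1 * ‖x - y‖) (x := y) (y := x)
    (fun z hz => ((hd κ hκ z hz.1).sub (by fun_prop))) (fun z hz => ?_)
    ⟨hy, mem_closedBall_self (norm_nonneg _)⟩ ⟨hx, by simp [dist_eq_norm]⟩
  · calc _ = ‖κ x - deriv κ y * x - (κ y - deriv κ y * y)‖ := by congr 1; ring
      _ ≤ _ := this
      _ = _ := by ring
  · rw [deriv_fun_sub (hd κ hκ z hz.1) (by fun_prop), deriv_const_mul_field, deriv_id'', mul_one]
    refine (hL z hz.1).trans ?_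
    have : ‖z - y‖ ≤ ‖x - y‖ := by simpa [dist_eq_norm] using hz.2
    gcongr

theorem lt_norm_of_quadratic_bound {a b E : ℂ} {s K : ℝ} (hs : 0 < s) (hK : 0 < K) (hb : b ≠ 0)
    (hre : b.re ≤ 0) (hE : ‖E‖ ≤ K * ‖b‖ ^ 2) (h : K * (‖b‖ + 2 * s) < ‖a‖) :
    ‖a‖ * s < ‖a * (b - s) + E‖ := by
  have hu : 0 < ‖b‖ := norm_pos_iff.2 hb
  have hv : ‖b - s‖ ^ 2 ≥ ‖b‖ ^ 2 + s ^ 2 := by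
    rw [← normSq_eq_norm_sq, ← normSq_eq_norm_sq, normSq_apply, normSq_apply]
    simp
    nlinarith
  have hv' : ‖b - s‖ ≤ ‖b‖ + s := by
    simpa [abs_of_pos hs] using norm_sub_le b (s : ℂ)
  have hvs : s < ‖b - s‖ := by nlinarith [norm_nonneg (b - s)]
  have h₁ : ‖a‖ * ‖b - s‖ - ‖E‖ ≤ ‖a * (b - s) + E‖ := by
    have := norm_sub_le (a * (b - s) + E) E
    rw [add_sub_cancel_right, norm_mul] at this
    linarith
  have h₂ : K * (‖b - s‖ + s) * (‖b - s‖ - s) < ‖a‖ * (‖b - s‖ - s) := by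
    refine mul_lt_mul_of_pos_right (lt_of_le_of_lt ?_ h) (by linarith)
    exact mul_le_mul_of_nonneg_left (by linarith) hK.le
  have h₃ : K * ‖b‖ ^ 2 ≤ K * (‖b - s‖ ^ 2 - s ^ 2) := by
    gcongr
    linarith
  nlinarith

theorem IsBoundaryChart.re_eq_zero {Ω : Set ℂ} {ζ₀ : ℂ} {κ : ℂ → ℂ} {δ : ℝ} (hΩ : IsOpen Ω)
    (hκ : IsBoundaryChart Ω ζ₀ κ δ) {x : ℂ} (hx : x ∈ ball 0 δ) (h : κ x ∈ frontier Ω) :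
    x.re = 0 := by
  rcases lt_trichotomy x.re 0 with h' | h' | h'
  · rw [hΩ.frontier_eq] at h
    exact absurd (hκ.mem_of_neg x hx h') h.2
  · exact h'
  · exact absurd h.1 (hκ.notMem_of_pos x hx h')

/-- Near a boundary point, all boundary points have exterior tangent discs of a common radius. -/
theorem MCDomain.exists_exterior_ball (D : MCDomain n) {ζ₀ : ℂ} (hζ : ζ₀ ∈ frontier D.Ω) :
    ∃ t > 0, ∃ ρ > 0, ∀ ζ₁ ∈ frontier D.Ω, ‖ζ₁ - ζ₀‖ < ρ →
      ∃ c, ‖c - ζ₁‖ = t ∧ ∀ w ∈ closure D.Ω, w ≠ ζ₁ → t < ‖w - c‖ := by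
  obtain ⟨κ, δ, hκ⟩ := D.exists_isBoundaryChart hζ
  have hδ := hκ.pos
  have hr : δ / 2 < δ := by linarith
  obtain ⟨K, hK, hquad⟩ := exists_quadratic_bound hκ.diff hr
  have hsub : closedBall (0 : ℂ) (δ / 2) ⊆ ball 0 δ := closedBall_subset_ball hr
  obtain ⟨m, hm, hmin⟩ : ∃ m > 0, ∀ x ∈ closedBall (0 : ℂ) (δ / 2), m ≤ ‖deriv κ x‖ := by
    obtain ⟨x, hx, hmin⟩ := (isCompact_closedBall (0 : ℂ) (δ / 2)).exists_isMinOn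
      ⟨0, mem_closedBall_self (by linarith)⟩
      ((hκ.diff.deriv isOpen_ball).continuousOn.mono hsub).norm
    exact ⟨‖deriv κ x‖,
      norm_pos_iff.2 (deriv_ne_zero_of_injOn isOpen_ball hκ.diff hκ.inj (hsub hx)),
      fun y hy => hmin hy⟩
  obtain ⟨u, hu, huδ, huK⟩ : ∃ u > 0, u ≤ δ / 2 ∧ K * (4 * u) < m := by
    refine ⟨min (δ / 2) (m / (8 * K)), by positivity, min_le_left _ _, ?_⟩
    have := min_le_right (δ / 2) (m / (8 * K))
    rw [le_div_iff₀ (by positivity)] at this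
    linarith
  have hub : ball (0 : ℂ) u ⊆ closedBall 0 (δ / 2) :=
    (ball_subset_ball huδ).trans ball_subset_closedBall
  have hopen : IsOpen (κ '' ball 0 u) :=
    isOpen_image_of_injOn isOpen_ball hκ.diff hκ.inj isOpen_ball (hub.trans hsub)
  obtain ⟨ρ, hρ, hball⟩ := Metric.isOpen_iff.1 hopen ζ₀ ⟨0, mem_ball_self hu, hκ.zero⟩
  refine ⟨min (m * u) (ρ / 7), by positivity, ρ / 3, by positivity, fun ζ₁ hζ₁ hd => ?_⟩
  set t := min (m * u) (ρ / 7) with ht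
  have htpos : 0 < t := by positivity
  have htm : t ≤ m * u := min_le_left _ _
  have htρ : t ≤ ρ / 7 := min_le_right _ _
  obtain ⟨y, hy, rfl⟩ := hball (a := ζ₁) (by rw [mem_ball, dist_eq_norm]; linarith)
  have hyr := hκ.re_eq_zero D.isOpen (hsub (hub hy)) hζ₁
  have hmy := hmin y (hub hy)
  set s := t / ‖deriv κ y‖ with hs
  have hspos : 0 < s := div_pos htpos (hm.trans_le hmy)
  have hsu : s ≤ u := by
    rw [hs, div_le_iff₀ (hm.trans_le hmy)]
    nlinarith
  have hst : ‖deriv κ y‖ * s = t := by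
    rw [hs]; field_simp [(hm.trans_le hmy).ne']
  refine ⟨κ y + deriv κ y * s, by simp [abs_of_pos hspos, hst], fun w hw hne => ?_⟩
  by_cases hwb : w ∈ ball ζ₀ ρ
  · obtain ⟨x, hx, rfl⟩ := hball hwb
    have hxr : x.re ≤ 0 := not_lt.1 fun h => hκ.notMem_of_pos x (hsub (hub hx)) h hw
    have hxy : ‖x - y‖ < 2 * u := by
      have := norm_sub_le x y
      have h₁ : ‖x‖ < u := by simpa using hx
      have h₂ : ‖y‖ < u := by simpa using hy
      linarith
    have := lt_norm_of_quadratic_bound (a := deriv κ y) (b := x - y) hspos hK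
      (sub_ne_zero.2 fun h => hne (h ▸ rfl)) (by simpa [hyr] using hxr)
      (hquad x (hub hx) y (hub hy)) (by nlinarith)
    rw [hst] at this
    convert this using 2
    ring
  · rw [mem_ball, not_lt, dist_eq_norm] at hwb
    have h₁ : ‖κ y + deriv κ y * s - κ y‖ = t := by simp [abs_of_pos hspos, hst]
    have h₂ := norm_sub_le_norm_sub_add_norm_sub w (κ y + deriv κ y * s) ζ₀
    have h₃ := norm_sub_le_norm_sub_add_norm_sub (κ y + deriv κ y * s) (κ y) ζ₀
    linarith

end ExteriorBall

section Nontangential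

variable {τ : ℂ → ℂ}

/-- The Stolz region with vertex `ζ` and aperture `a`. -/
def stolzRegion (a : ℝ) (ζ : ℂ) : Set ℂ := {z | ‖z - ζ‖ + a * ‖z‖ < a}

theorem stolzRegion_subset_ball {a : ℝ} (ha : 0 < a) (ζ : ℂ) :
    stolzRegion a ζ ⊆ ball 0 1 := fun z hz => by
  have h : ‖z - ζ‖ + a * ‖z‖ < a := hz
  rw [mem_ball_zero_iff]
  nlinarith [norm_nonneg (z - ζ)]

theorem stolzRegion_eq {a : ℝ} (ha : 0 < a) (ζ : ℂ) :
    {z ∈ ball (0 : ℂ) 1 | ‖z - ζ‖ < a * infDist z (ball 0 1)ᶜ} = stolzRegion a ζ := by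
  ext z
  constructor
  · rintro ⟨hz, h⟩
    rw [infDist_compl_ball hz] at h
    change ‖z - ζ‖ + a * ‖z‖ < a
    linarith
  · intro h
    have hz := stolzRegion_subset_ball ha ζ h
    refine ⟨hz, ?_⟩
    rw [infDist_compl_ball hz]
    have h : ‖z - ζ‖ + a * ‖z‖ < a := h
    linarith

theorem convex_stolzRegion {a : ℝ} (ha : 0 < a) (ζ : ℂ) : Convex ℝ (stolzRegion a ζ) := by
  intro x hx y hy s t hs ht hst
  have hx : ‖x - ζ‖ + a * ‖x‖ < a := hx
  have hy : ‖y - ζ‖ + a * ‖y‖ < a := hy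
  change ‖s • x + t • y - ζ‖ + a * ‖s • x + t • y‖ < a
  have h₁ : ‖s • x + t • y - ζ‖ ≤ s * ‖x - ζ‖ + t * ‖y - ζ‖ := by
    have : s • x + t • y - ζ = s • (x - ζ) + t • (y - ζ) := by
      rw [smul_sub, smul_sub, sub_add_sub_comm, ← add_smul, hst, one_smul]
    rw [this]
    refine (norm_add_le _ _).trans_eq ?_
    rw [norm_smul, norm_smul, Real.norm_of_nonneg hs, Real.norm_of_nonneg ht]
  have h₂ : ‖s • x + t • y‖ ≤ s * ‖x‖ + t * ‖y‖ := by
    refine (norm_add_le _ _).trans_eq ?_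
    rw [norm_smul, norm_smul, Real.norm_of_nonneg hs, Real.norm_of_nonneg ht]
  have h₃ := mul_le_mul_of_nonneg_left h₂ ha.le
  obtain rfl : t = 1 - s := by linarith
  rcases hs.eq_or_lt with rfl | hs
  · simp at *
    linarith
  · nlinarith

theorem mem_stolzRegion_of_dilate {a r : ℝ} (ha : 0 < a) {ζ z : ℂ} (hζ : ‖ζ‖ = 1)
    (hz : z ∈ stolzRegion a ζ) (hr : 0 < r) (hr1 : r ≤ 1) :
    ζ + r * (z - ζ) ∈ stolzRegion a ζ := by
  have hz : ‖z - ζ‖ + a * ‖z‖ < a := hz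
  change ‖ζ + r * (z - ζ) - ζ‖ + a * ‖ζ + r * (z - ζ)‖ < a
  have h₁ : ‖ζ + r * (z - ζ) - ζ‖ = r * ‖z - ζ‖ := by simp [abs_of_pos hr]
  have h₂ : ‖ζ + r * (z - ζ)‖ ≤ (1 - r) + r * ‖z‖ := by
    calc _ = ‖((1 - r : ℝ) : ℂ) * ζ + r * z‖ := by congr 1; push_cast; ring
      _ ≤ _ := norm_add_le _ _
      _ = _ := by
        rw [norm_mul, norm_mul, hζ, norm_real, norm_real, Real.norm_of_nonneg hr.le,
          Real.norm_of_nonneg (by linarith), mul_one]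
  have h₃ := mul_le_mul_of_nonneg_left h₂ ha.le
  rw [h₁]
  nlinarith

theorem exists_mem_frontier_infDist_eq {Ω : Set ℂ} (hΩ : IsOpen Ω) (hne : Ωᶜ.Nonempty) {w : ℂ}
    (hw : w ∈ Ω) : 0 < infDist w Ωᶜ ∧ ∃ ζ ∈ frontier Ω, infDist w Ωᶜ = ‖w - ζ‖ := by
  have hpos : 0 < infDist w Ωᶜ :=
    (hΩ.isClosed_compl.notMem_iff_infDist_pos hne).1 fun h => h hw
  obtain ⟨ζ, hζ, he⟩ := hΩ.isClosed_compl.exists_infDist_eq_dist hne w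
  refine ⟨hpos, ζ, ?_, he.trans (dist_eq_norm _ _)⟩
  rw [hΩ.frontier_eq]
  refine ⟨closure_mono (ball_infDist_compl_subset (s := Ω) (x := w)) ?_, hζ⟩
  rw [closure_ball _ hpos.ne', mem_closedBall, dist_comm, he]

theorem infDist_le_norm_sub_sub {Ω : Set ℂ} {c w : ℂ} {t : ℝ} (ht : 0 < t)
    (h : ∀ v, ‖v - c‖ ≤ t → v ∉ Ω) (hw : t < ‖w - c‖) : infDist w Ωᶜ ≤ ‖w - c‖ - t := by
  have hpos := ht.trans hw
  have hv : c + (t / ‖w - c‖ : ℝ) * (w - c) ∈ Ωᶜ := h _ (by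
    rw [add_sub_cancel_left, norm_mul, norm_real, Real.norm_of_nonneg (by positivity),
      div_mul_cancel₀ _ hpos.ne'])
  refine (infDist_le_dist_of_mem hv).trans_eq ?_
  have : w - (c + (t / ‖w - c‖ : ℝ) * (w - c)) = ((1 - t / ‖w - c‖ : ℝ) : ℂ) * (w - c) := by
    push_cast; ring
  have h1 : t / ‖w - c‖ < 1 := (div_lt_one hpos).2 hw
  rw [dist_eq_norm, this, norm_mul, norm_real, Real.norm_of_nonneg (by linarith)]
  field_simp

theorem MCDomain.exists_infDist_lower_bound (D : MCDomain n) (hτ : IsCoveringOfDisk D.Ω D.w₀ τ)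
    {ζ₀ : ℂ} (hζ₀ : ζ₀ ∈ frontier D.Ω) : ∃ C > 0, ∃ ρ > 0, ∀ z ∈ ball (0 : ℂ) 1,
      ‖τ z - ζ₀‖ < ρ → 1 - ‖z‖ ≤ C * infDist (τ z) D.Ωᶜ ∧
        ‖deriv τ z‖ * (1 - ‖z‖) ≤ C * infDist (τ z) D.Ωᶜ := by
  have hne : D.Ωᶜ.Nonempty := ⟨ζ₀, by rw [D.isOpen.frontier_eq] at hζ₀; exact hζ₀.2⟩
  obtain ⟨t, ht, ρ, hρ, hext⟩ := D.exists_exterior_ball hζ₀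
  obtain ⟨hd₀, -⟩ := exists_mem_frontier_infDist_eq D.isOpen hne D.base_mem
  set d₀ := infDist D.w₀ D.Ωᶜ
  set M := ‖D.w₀ - ζ₀‖ + ρ + t with hM
  have hMpos : 0 < M := by positivity
  have hC₁ : 0 < 4 * M / (d₀ * t) := by positivity
  have hC₂ : 0 < 2 * (ρ + t) ^ 2 / t ^ 2 := by positivity
  refine ⟨4 * M / (d₀ * t) + 2 * (ρ + t) ^ 2 / t ^ 2, by positivity, ρ / 3, by positivity,
    fun z hz hzρ => ?_⟩
  have hτz := hτ.mapsTo z hz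
  obtain ⟨hd, ζ₁, hζ₁, hdζ⟩ := exists_mem_frontier_infDist_eq D.isOpen hne hτz
  have hdρ : infDist (τ z) D.Ωᶜ ≤ ‖τ z - ζ₀‖ := by
    rw [← dist_eq_norm]
    refine infDist_le_dist_of_mem ?_
    rw [D.isOpen.frontier_eq] at hζ₀
    exact hζ₀.2
  set d := infDist (τ z) D.Ωᶜ
  have h10 : ‖ζ₁ - ζ₀‖ < ρ := by
    have := norm_sub_le_norm_sub_add_norm_sub ζ₁ (τ z) ζ₀
    rw [norm_sub_rev ζ₁ (τ z)] at this
    linarith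
  obtain ⟨c, hc, hout⟩ := hext ζ₁ hζ₁ h10
  have hζ₁Ω : ζ₁ ∉ D.Ω := by rw [D.isOpen.frontier_eq] at hζ₁; exact hζ₁.2
  have hout' : ∀ w ∈ D.Ω, t < ‖w - c‖ := fun w hw =>
    hout w (subset_closure hw) fun h => hζ₁Ω (h ▸ hw)
  have hlt : ∀ v ∈ ball (0 : ℂ) 1, t < ‖τ v - c‖ := fun v hv => hout' _ (hτ.mapsTo v hv)
  have hne' : ∀ v ∈ ball (0 : ℂ) 1, τ v - c ≠ 0 := fun v hv =>
    norm_pos_iff.1 (ht.trans (hlt v hv))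
  set q : ℂ → ℂ := fun v => t / (τ v - c) with hq
  have hqd : DifferentiableOn ℂ q (ball 0 1) :=
    (differentiableOn_const _).div (hτ.diff.sub_const c) hne'
  have hqn : ∀ v, ‖q v‖ = t / ‖τ v - c‖ := fun v => by simp [hq, abs_of_pos ht]
  have hq1 : ∀ v ∈ ball (0 : ℂ) 1, ‖q v‖ < 1 := fun v hv => by
    rw [hqn, div_lt_one (ht.trans (hlt v hv))]
    exact hlt v hv
  have hzc : ‖τ z - c‖ ≤ d + t := by
    have := norm_sub_le_norm_sub_add_norm_sub (τ z) ζ₁ c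
    rw [norm_sub_rev ζ₁, hc] at this
    linarith
  have hqz : 1 - ‖q z‖ ≤ d / t := by
    have hp := ht.trans (hlt z hz)
    rw [hqn, one_sub_div hp.ne', div_le_div_iff₀ hp ht]
    nlinarith [hlt z hz]
  have hz1 : 0 < 1 - ‖z‖ := by simpa using hz
  constructor
  · have h0 : (0 : ℂ) ∈ ball (0 : ℂ) 1 := mem_ball_self one_pos
    have h₁ := schwarz_pick_lower hqd hq1 hz
    rw [sub_zero, div_one] at h₁
    have h₂ : d₀ / M ≤ 1 - ‖q 0‖ := by
      have hp := ht.trans (hlt 0 h0)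
      have h₃ := infDist_le_norm_sub_sub ht (fun v hv hvΩ => (hout' v hvΩ).not_ge hv)
        (hout' _ D.base_mem)
      have h₄ : ‖D.w₀ - c‖ ≤ M := by
        have h₅ := norm_sub_le_norm_sub_add_norm_sub D.w₀ ζ₀ c
        have h₆ := norm_sub_le_norm_sub_add_norm_sub ζ₀ ζ₁ c
        rw [norm_sub_rev ζ₁ c, hc, norm_sub_rev ζ₀ ζ₁] at h₆
        linarith
      rw [hqn, one_sub_div hp.ne', hτ.base]
      rw [hτ.base] at hp
      exact div_le_div₀ (hd₀.le.trans h₃) h₃ hp h₄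
    have h₃ : d₀ / M * (1 - ‖z‖) ≤ 4 * (d / t) :=
      (mul_le_mul_of_nonneg_right h₂ hz1.le).trans (h₁.trans (by linarith))
    have h₄ : 1 - ‖z‖ ≤ 4 * M / (d₀ * t) * d := by
      rw [div_mul_eq_mul_div, ← mul_div_assoc, div_le_div_iff₀ hMpos ht] at h₃
      rw [div_mul_eq_mul_div, le_div_iff₀ (by positivity)]
      linarith
    nlinarith
  · have hsub : ball z (1 - ‖z‖) ⊆ ball 0 1 := ball_subset_ball' (by simp)
    have h₁ := schwarz_pick_deriv (hqd.mono hsub) (fun v hv => hq1 v (hsub hv)) hz1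
    have hτd := (hτ.diff.differentiableAt (isOpen_ball.mem_nhds hz)).hasDerivAt
    have h₂ : deriv q z = -(t * deriv τ z) / (τ z - c) ^ 2 := by
      have := ((hasDerivAt_const z (t : ℂ)).div (hτd.sub_const c) (hne' z hz)).deriv
      simpa [Pi.div_def] using this
    have h₃ : ‖deriv τ z‖ = ‖deriv q z‖ * (‖τ z - c‖ ^ 2 / t) := by
      have hp := ht.trans (hlt z hz)
      rw [h₂, norm_div, norm_neg, norm_mul, norm_pow, norm_real, Real.norm_of_nonneg ht.le]
      field_simp
    have h₄ : ‖τ z - c‖ ^ 2 / t ≤ (ρ + t) ^ 2 / t := by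
      gcongr
      linarith
    have h₅ : ‖deriv τ z‖ * (1 - ‖z‖) ≤ 2 * (d / t) * ((ρ + t) ^ 2 / t) := by
      rw [h₃, mul_right_comm]
      exact mul_le_mul (h₁.trans (by linarith)) h₄ (by positivity) (by positivity)
    have h₆ : 2 * (d / t) * ((ρ + t) ^ 2 / t) = 2 * (ρ + t) ^ 2 / t ^ 2 * d := by
      field_simp
    nlinarith

end Nontangential

section NontangentialComposition

variable {τ : ℂ → ℂ}

theorem IsBoundaryChart.re_neg {Ω : Set ℂ} {ζ₀ : ℂ} {κ : ℂ → ℂ} {δ : ℝ} (hΩ : IsOpen Ω)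
    (hκ : IsBoundaryChart Ω ζ₀ κ δ) {x : ℂ} (hx : x ∈ ball 0 δ) (h : κ x ∈ Ω) : x.re < 0 := by
  rcases lt_trichotomy x.re 0 with h' | h' | h'
  · exact h'
  · have := hκ.mem_frontier x hx h'
    rw [hΩ.frontier_eq] at this
    exact absurd h this.2
  · exact absurd (subset_closure h) (hκ.notMem_of_pos x hx h')

theorem IsBoundaryChart.exists_infDist_le {Ω : Set ℂ} {ζ₀ : ℂ} {κ : ℂ → ℂ} {δ : ℝ}
    (hΩ : IsOpen Ω) (hκ : IsBoundaryChart Ω ζ₀ κ δ) :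
    ∃ C > 0, ∀ x ∈ ball (0 : ℂ) (δ / 2), x.re < 0 → infDist (κ x) Ωᶜ ≤ C * -x.re := by
  have hδ := hκ.pos
  have hsub : closedBall (0 : ℂ) (δ / 2) ⊆ ball 0 δ := closedBall_subset_ball (by linarith)
  obtain ⟨C, hC⟩ := (isCompact_closedBall (0 : ℂ) (δ / 2)).exists_bound_of_continuousOn
    ((hκ.diff.deriv isOpen_ball).continuousOn.mono hsub)
  refine ⟨max C 1, by positivity, fun x hx hxr => ?_⟩
  have hx' : x ∈ closedBall (0 : ℂ) (δ / 2) := ball_subset_closedBall hx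
  have hy : (x.im : ℂ) * I ∈ closedBall (0 : ℂ) (δ / 2) := by
    have h : ‖x‖ ≤ δ / 2 := by simpa using hx'
    simpa using (abs_im_le_norm x).trans h
  have hyΩ : κ (x.im * I) ∈ Ωᶜ := by
    have := hκ.mem_frontier _ (hsub hy) (by simp)
    rw [hΩ.frontier_eq] at this
    exact this.2
  refine (infDist_le_dist_of_mem hyΩ).trans ?_
  rw [dist_eq_norm]
  refine ((convex_closedBall (0 : ℂ) (δ / 2)).norm_image_sub_le_of_norm_deriv_le
    (fun z hz => hκ.diff.differentiableAt (isOpen_ball.mem_nhds (hsub hz)))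
    (fun z hz => (hC z hz).trans (le_max_left C 1)) hy hx').trans_eq ?_
  have : x - x.im * I = (x.re : ℂ) := by
    apply Complex.ext <;> simp
  rw [this, norm_real, Real.norm_of_nonpos hxr.le]

/-- If `τ` lifts a half-disc chart through the disc, the chart depth is comparable to the distance
to the circle. -/
theorem exists_neg_re_le_of_lift {s : ℂ → ℂ} {δ : ℝ} (hδ : 0 < δ)
    (hs : DifferentiableOn ℂ s (ball 0 δ ∩ {x | x.re < 0}))
    (hs1 : ∀ x ∈ ball (0 : ℂ) δ ∩ {x | x.re < 0}, s x ∈ ball (0 : ℂ) 1) :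
    ∃ C > 0, ∀ x ∈ ball (0 : ℂ) (δ / 4), x.re < 0 → -x.re ≤ C * (1 - ‖s x‖) := by
  have hPn : ∀ y : ℝ, |y| ≤ δ / 4 → ‖(y : ℂ) * I - (δ / 4 : ℝ)‖ ≤ δ / 2 := fun y hy => by
    refine (norm_sub_le _ _).trans ?_
    rw [norm_mul, norm_I, norm_real, norm_real, Real.norm_of_nonneg (by positivity : 0 ≤ δ / 4),
      Real.norm_eq_abs]
    linarith
  have hball : ∀ y : ℝ, |y| ≤ δ / 4 →
      ball ((y : ℂ) * I - (δ / 4 : ℝ)) (δ / 4) ⊆ ball 0 δ ∩ {x | x.re < 0} := by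
    intro y hy x hx
    rw [mem_ball, dist_eq_norm] at hx
    refine ⟨?_, ?_⟩
    · have h₁ := norm_le_norm_add_norm_sub ((y : ℂ) * I - (δ / 4 : ℝ)) x
      rw [norm_sub_rev _ x] at h₁
      rw [mem_ball_zero_iff]
      linarith [hPn y hy]
    · have h₁ := (abs_lt.1 ((abs_re_le_norm _).trans_lt hx)).2
      have h₂ : (x - ((y : ℂ) * I - (δ / 4 : ℝ))).re = x.re + δ / 4 := by simp
      rw [h₂] at h₁
      change x.re < 0
      linarith
  have hcont : ContinuousOn (fun y : ℝ => 1 - ‖s ((y : ℂ) * I - (δ / 4 : ℝ))‖)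
      (Icc (-(δ / 4)) (δ / 4)) := by
    refine continuousOn_const.sub (ContinuousOn.norm (hs.continuousOn.comp (by fun_prop) ?_))
    exact fun y hy => hball y (abs_le.2 hy) (mem_ball_self (by positivity))
  obtain ⟨y₀, hy₀, hmin⟩ := isCompact_Icc.exists_isMinOn
    ⟨0, by constructor <;> linarith⟩ hcont
  set μ := 1 - ‖s ((y₀ : ℂ) * I - (δ / 4 : ℝ))‖ with hμ
  have hμpos : 0 < μ := by
    simpa [hμ] using hs1 _ (hball y₀ (abs_le.2 hy₀) (mem_ball_self (by positivity)))
  refine ⟨δ / μ, by positivity, fun x hx hxr => ?_⟩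
  have hxn : ‖x‖ < δ / 4 := by simpa using hx
  have hxi : |x.im| ≤ δ / 4 := ((abs_im_le_norm x).trans_lt hxn).le
  have hxre : -x.re < δ / 4 := by
    have := (abs_re_le_norm x).trans_lt hxn
    rw [abs_of_neg hxr] at this
    exact this
  have hxP : x - ((x.im : ℂ) * I - (δ / 4 : ℝ)) = ((x.re + δ / 4 : ℝ) : ℂ) := by
    apply Complex.ext <;> simp
  have hxPn : ‖x - ((x.im : ℂ) * I - (δ / 4 : ℝ))‖ = x.re + δ / 4 := by
    rw [hxP, norm_real, Real.norm_of_nonneg (by linarith)]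
  have h := schwarz_pick_lower (hs.mono (hball x.im hxi))
    (fun z hz => by simpa using hs1 z (hball x.im hxi hz))
    (z := x) (by rw [mem_ball, dist_eq_norm, hxPn]; linarith)
  have hμx : μ ≤ 1 - ‖s ((x.im : ℂ) * I - (δ / 4 : ℝ))‖ := hmin (abs_le.1 hxi)
  have he : 1 - (x.re + δ / 4) / (δ / 4) = 4 * -x.re / δ := by
    field_simp
    ring
  rw [hxPn, he] at h
  have h₂ : μ * (4 * -x.re / δ) ≤ 4 * (1 - ‖s x‖) :=
    (mul_le_mul_of_nonneg_right hμx (div_nonneg (by linarith) hδ.le)).trans h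
  rw [← mul_div_assoc, div_le_iff₀ hδ] at h₂
  rw [div_mul_eq_mul_div, le_div_iff₀ hμpos]
  linarith

theorem MCDomain.exists_infDist_upper_bound (D : MCDomain n) (hτ : IsCoveringOfDisk D.Ω D.w₀ τ)
    {ζ ζ₀ : ℂ} (hζ₀ : ζ₀ ∈ frontier D.Ω) {a : ℝ} (ha : 0 < a)
    (hlim : Tendsto τ (𝓝[stolzRegion a ζ] ζ) (𝓝 ζ₀)) :
    ∃ C > 0, ∃ η > 0, ∀ z ∈ stolzRegion a ζ ∩ ball ζ η,
      infDist (τ z) D.Ωᶜ ≤ C * (1 - ‖z‖) := by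
  obtain ⟨κ, δ, hκ⟩ := D.exists_isBoundaryChart hζ₀
  have hδ := hκ.pos
  have h4 : ball (0 : ℂ) (δ / 4) ⊆ ball 0 δ := ball_subset_ball (by linarith)
  have hV : IsOpen (κ '' ball 0 (δ / 4)) :=
    isOpen_image_of_injOn isOpen_ball hκ.diff hκ.inj isOpen_ball h4
  have hev := hlim.eventually_mem (hV.mem_nhds ⟨0, mem_ball_self (by positivity), hκ.zero⟩)
  obtain ⟨η, hη, hS⟩ := Metric.mem_nhdsWithin_iff.1 hev
  have hSb : stolzRegion a ζ ∩ ball ζ η ⊆ ball 0 1 :=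
    inter_subset_left.trans (stolzRegion_subset_ball ha ζ)
  have hSV : ∀ z ∈ stolzRegion a ζ ∩ ball ζ η, τ z ∈ κ '' ball 0 (δ / 4) :=
    fun z hz => hS ⟨hz.2, hz.1⟩
  rcases (stolzRegion a ζ ∩ ball ζ η).eq_empty_or_nonempty with he | ⟨z₁, hz₁⟩
  · exact ⟨1, one_pos, η, hη, fun z hz => absurd hz (he ▸ notMem_empty z)⟩
  have hSc : IsPreconnected (stolzRegion a ζ ∩ ball ζ η) :=
    ((convex_stolzRegion ha ζ).inter (convex_ball ζ η)).isPreconnected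
  obtain ⟨t, ht, hinv⟩ := exists_holomorphic_inverse isOpen_ball hκ.diff hκ.inj
  have htS : ∀ z ∈ stolzRegion a ζ ∩ ball ζ η, t (τ z) ∈ ball (0 : ℂ) (δ / 4) ∧
      (t (τ z)).re < 0 ∧ κ (t (τ z)) = τ z := by
    intro z hz
    obtain ⟨x, hx, hxe⟩ := hSV z hz
    have hzΩ := hτ.mapsTo z (hSb hz)
    rw [← hxe] at hzΩ ⊢
    rw [hinv x (h4 hx)]
    exact ⟨hx, hκ.re_neg D.isOpen (h4 hx) hzΩ, rfl⟩
  have hQo : IsOpen (ball (0 : ℂ) δ ∩ {x | x.re < 0}) :=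
    isOpen_ball.inter (isOpen_lt continuous_re continuous_const)
  have htQ : ∀ z ∈ stolzRegion a ζ ∩ ball ζ η, t (τ z) ∈ ball (0 : ℂ) δ ∩ {x | x.re < 0} :=
    fun z hz => ⟨h4 (htS z hz).1, (htS z hz).2.1⟩
  obtain ⟨s, hs, hs1, hsκ, hsx⟩ := hτ.exists_lift hQo
    ((convex_ball _ _).inter (convex_halfSpace_re_lt 0)) (hκ.diff.mono inter_subset_left)
    (fun x hx => hκ.mem_of_neg x hx.1 hx.2) (htQ z₁ hz₁) (hSb hz₁) (htS z₁ hz₁).2.2.symm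
  have hτc : ContinuousOn τ (stolzRegion a ζ ∩ ball ζ η) := hτ.diff.continuousOn.mono hSb
  have htc : ContinuousOn (fun z => t (τ z)) (stolzRegion a ζ ∩ ball ζ η) :=
    ht.continuousOn.comp hτc fun z hz => image_mono h4 (hSV z hz)
  have hid := hτ.eqOn_of_comp_eq hSc (s₁ := fun z => s (t (τ z))) (s₂ := fun z => z)
    (hs.continuousOn.comp htc htQ) continuousOn_id (fun z hz => hs1 _ (htQ z hz)) hSb
    (fun z hz => (hsκ _ (htQ z hz)).trans (htS z hz).2.2) hz₁ hsx
  obtain ⟨C₁, hC₁, h₁⟩ := hκ.exists_infDist_le D.isOpen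
  obtain ⟨C₂, hC₂, h₂⟩ := exists_neg_re_le_of_lift hδ hs hs1
  refine ⟨C₁ * C₂, by positivity, η, hη, fun z hz => ?_⟩
  obtain ⟨hx, hxr, hxe⟩ := htS z hz
  have h₃ := h₁ _ (ball_subset_ball (by linarith) hx) hxr
  have h₄ := h₂ _ hx hxr
  have h₅ : s (t (τ z)) = z := hid z hz
  rw [hxe] at h₃
  rw [h₅] at h₄
  rw [mul_assoc]
  exact h₃.trans (by gcongr)

theorem MCDomain.exists_approach_region (D : MCDomain n) (hτ : IsCoveringOfDisk D.Ω D.w₀ τ)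
    {ζ ζ₀ : ℂ} (hζ : ‖ζ‖ = 1) (hζ₀ : ζ₀ ∈ frontier D.Ω) {a : ℝ} (ha : 0 < a)
    (hlim : Tendsto τ (𝓝[stolzRegion a ζ] ζ) (𝓝 ζ₀)) :
    ∃ b > 1, ∀ᶠ z in 𝓝[stolzRegion a ζ] ζ, ‖τ z - ζ₀‖ < b * infDist (τ z) D.Ωᶜ := by
  obtain ⟨C₁, hC₁, ρ, hρ, hlow⟩ := D.exists_infDist_lower_bound hτ hζ₀
  obtain ⟨C₂, hC₂, η₀, hη₀, hup⟩ := D.exists_infDist_upper_bound hτ hζ₀ ha hlim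
  obtain ⟨η₁, hη₁, hS₁⟩ := Metric.mem_nhdsWithin_iff.1
    (hlim.eventually_mem (ball_mem_nhds ζ₀ hρ))
  set η := min η₀ η₁ with hη
  have hηpos : 0 < η := lt_min hη₀ hη₁
  set S := stolzRegion a ζ ∩ ball ζ η with hS
  have hSb : S ⊆ ball 0 1 := inter_subset_left.trans (stolzRegion_subset_ball ha ζ)
  have hSconv : Convex ℝ S := (convex_stolzRegion ha ζ).inter (convex_ball ζ η)
  have hSρ : ∀ z ∈ S, ‖τ z - ζ₀‖ < ρ := fun z hz => by
    have : τ z ∈ ball ζ₀ ρ := hS₁ ⟨ball_subset_ball (min_le_right _ _) hz.2, hz.1⟩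
    rwa [mem_ball, dist_eq_norm] at this
  have hSup : ∀ z ∈ S, infDist (τ z) D.Ωᶜ ≤ C₂ * (1 - ‖z‖) := fun z hz =>
    hup z ⟨hz.1, ball_subset_ball (min_le_left _ _) hz.2⟩
  have hder : ∀ z ∈ S, ‖deriv τ z‖ ≤ C₁ * C₂ := fun z hz => by
    have h1 : 0 < 1 - ‖z‖ := by simpa using hSb hz
    refine le_of_mul_le_mul_right ?_ h1
    calc _ ≤ C₁ * infDist (τ z) D.Ωᶜ := (hlow z (hSb hz) (hSρ z hz)).2
      _ ≤ C₁ * (C₂ * (1 - ‖z‖)) := by gcongr; exact hSup z hz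
      _ = _ := by ring
  refine ⟨C₁ * C₂ * a * C₁ + 1, by simp; positivity, ?_⟩
  filter_upwards [inter_mem_nhdsWithin (stolzRegion a ζ) (ball_mem_nhds ζ hηpos)] with z hz
  have hz : z ∈ S := hz
  have hdil : ∀ r : ℝ, 0 < r → r ≤ 1 → ζ + r * (z - ζ) ∈ S := fun r hr hr1 => by
    refine ⟨mem_stolzRegion_of_dilate ha hζ hz.1 hr hr1, ?_⟩
    have : ‖z - ζ‖ < η := by simpa [dist_eq_norm] using hz.2
    rw [mem_ball, dist_eq_norm, add_sub_cancel_left, norm_mul, norm_real,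
      Real.norm_of_nonneg hr.le]
    nlinarith [norm_nonneg (z - ζ)]
  have hev : ∀ᶠ r : ℝ in 𝓝[>] 0, ζ + r * (z - ζ) ∈ S := by
    filter_upwards [Ioc_mem_nhdsGT (zero_lt_one' ℝ)] with r hr using hdil r hr.1 hr.2
  have htend : Tendsto (fun r : ℝ => ζ + r * (z - ζ)) (𝓝[>] 0) (𝓝 ζ) := by
    have : Continuous fun r : ℝ => ζ + r * (z - ζ) := by fun_prop
    simpa using (this.tendsto 0).mono_left nhdsWithin_le_nhds
  have hτtend : Tendsto (fun r : ℝ => τ (ζ + r * (z - ζ))) (𝓝[>] 0) (𝓝 ζ₀) :=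
    hlim.comp (tendsto_nhdsWithin_iff.2 ⟨htend, hev.mono fun r hr => hr.1⟩)
  have hle : ‖τ z - ζ₀‖ ≤ C₁ * C₂ * ‖z - ζ‖ := by
    refine le_of_tendsto_of_tendsto (tendsto_const_nhds.sub hτtend).norm
      ((tendsto_const_nhds.sub htend).norm.const_mul (C₁ * C₂)) ?_
    filter_upwards [hev] with r hr
    exact hSconv.norm_image_sub_le_of_norm_deriv_le
      (fun v hv => hτ.diff.differentiableAt (isOpen_ball.mem_nhds (hSb hv))) hder hr hz
  have h₁ : ‖z - ζ‖ ≤ a * (1 - ‖z‖) := by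
    have : ‖z - ζ‖ + a * ‖z‖ < a := hz.1
    linarith
  have h₂ := (hlow z (hSb hz) (hSρ z hz)).1
  have hne : D.Ωᶜ.Nonempty := ⟨ζ₀, by rw [D.isOpen.frontier_eq] at hζ₀; exact hζ₀.2⟩
  have hpos := (exists_mem_frontier_infDist_eq D.isOpen hne (hτ.mapsTo z (hSb hz))).1
  calc ‖τ z - ζ₀‖ ≤ C₁ * C₂ * (a * (C₁ * infDist (τ z) D.Ωᶜ)) :=
        hle.trans (by gcongr; exact h₁.trans (by gcongr))
    _ < _ := by linarith

/-- Nontangential limits are transported by a covering map of the disc. -/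
theorem MCDomain.ntLim_comp (D : MCDomain n) (hτ : IsCoveringOfDisk D.Ω D.w₀ τ)
    {g : ℂ → ℂ} {ζ ζ₀ L : ℂ} (hζ : ‖ζ‖ = 1) (hζ₀ : ζ₀ ∈ frontier D.Ω)
    (hlim : NTLim (ball 0 1) τ ζ ζ₀) (hg : NTLim D.Ω g ζ₀ L) :
    NTLim (ball 0 1) (fun z => g (τ z)) ζ L := by
  intro a ha
  have ha0 : 0 < a := one_pos.trans ha
  have hl := hlim a ha
  rw [stolzRegion_eq ha0] at hl ⊢
  obtain ⟨b, hb, hev⟩ := D.exists_approach_region hτ hζ hζ₀ ha0 hl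
  refine (hg b hb).comp (tendsto_nhdsWithin_iff.2 ⟨hl, ?_⟩)
  filter_upwards [hev, self_mem_nhdsWithin] with z hz hzS
  exact ⟨hτ.mapsTo z (stolzRegion_subset_ball ha0 ζ hzS), hz⟩

end NontangentialComposition

section HarmonicMeasure

variable {τ τb : ℂ → ℂ}

/-- A holomorphic barrier at a boundary point. -/
theorem MCDomain.exists_barrier (D : MCDomain n) {ζ₀ : ℂ} (hζ₀ : ζ₀ ∈ frontier D.Ω) :
    ∃ B : ℂ → ℂ, Measurable B ∧ (∀ w ∈ closure D.Ω, DifferentiableAt ℂ B w) ∧ B ζ₀ = 0 ∧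
      ∀ w ∈ closure D.Ω, w ≠ ζ₀ → 0 < (B w).re := by
  obtain ⟨t, ht, ρ, hρ, hext⟩ := D.exists_exterior_ball hζ₀
  obtain ⟨c, hc, hout⟩ := hext ζ₀ hζ₀ (by simpa using hρ)
  have hζc : ζ₀ - c ≠ 0 := by
    rw [← norm_pos_iff, norm_sub_rev, hc]
    exact ht
  have hwc : ∀ w ∈ closure D.Ω, w - c ≠ 0 := fun w hw => by
    by_cases h : w = ζ₀
    · exact h ▸ hζc
    · exact norm_pos_iff.1 (ht.trans (hout w hw h))
  refine ⟨fun w => 1 - (ζ₀ - c) / (w - c), by fun_prop, fun w hw => ?_, ?_, fun w hw hne => ?_⟩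
  · exact (differentiableAt_const _).sub
      ((differentiableAt_const _).div (by fun_prop) (hwc w hw))
  · simp [div_self hζc]
  · have h₁ : ‖(ζ₀ - c) / (w - c)‖ < 1 := by
      rw [norm_div, norm_sub_rev, hc, div_lt_one (ht.trans (hout w hw hne))]
      exact hout w hw hne
    have h₂ := (re_le_norm ((ζ₀ - c) / (w - c))).trans_lt h₁
    rw [sub_re, one_re]
    linarith

theorem exists_abs_sub_le_add_mul {K : Set ℂ} (hK : IsCompact K) {φ b : ℂ → ℝ}
    (hφ : ContinuousOn φ K) {ζ₀ : ℂ} (hζ₀ : ζ₀ ∈ K) (hb : ContinuousOn b K)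
    (hb0 : ∀ w ∈ K, 0 ≤ b w) (hpos : ∀ w ∈ K, w ≠ ζ₀ → 0 < b w) {ε : ℝ} (hε : 0 < ε) :
    ∃ C, 0 ≤ C ∧ ∀ w ∈ K, |φ w - φ ζ₀| ≤ ε + C * b w := by
  obtain ⟨r, hr, hnear⟩ := Metric.continuousOn_iff.1 hφ ζ₀ hζ₀ ε hε
  have hcpt : IsCompact (K \ ball ζ₀ r) := hK.diff isOpen_ball
  obtain ⟨M, hM⟩ := hK.exists_bound_of_continuousOn (f := fun w => φ w - φ ζ₀)
    (hφ.sub continuousOn_const)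
  obtain ⟨m, hm, hmin⟩ : ∃ m > 0, ∀ w ∈ K \ ball ζ₀ r, m ≤ b w := by
    rcases (K \ ball ζ₀ r).eq_empty_or_nonempty with he | hne
    · exact ⟨1, one_pos, fun w hw => absurd hw (he ▸ notMem_empty w)⟩
    · obtain ⟨w, hw, hmin⟩ := hcpt.exists_isMinOn hne (hb.mono sdiff_subset)
      refine ⟨b w, hpos w hw.1 fun h => hw.2 (h ▸ mem_ball_self hr), fun v hv => hmin hv⟩
  have hM0 : 0 ≤ M := (norm_nonneg _).trans (hM ζ₀ hζ₀)
  refine ⟨M / m, by positivity, fun w hw => ?_⟩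
  by_cases h : w ∈ ball ζ₀ r
  · have h₁ := hnear w hw h
    rw [Real.dist_eq] at h₁
    have h₂ : 0 ≤ M / m * b w := mul_nonneg (by positivity) (hb0 w hw)
    linarith
  · have h₁ : |φ w - φ ζ₀| ≤ M := hM w hw
    have h₂ : M ≤ M / m * b w := by
      rw [div_mul_eq_mul_div, le_div_iff₀ hm]
      exact mul_le_mul_of_nonneg_left (hmin w ⟨hw, h⟩) hM0
    linarith

theorem MCDomain.isCompact_closure (D : MCDomain n) : IsCompact (closure D.Ω) :=
  D.bdd.isCompact_closure

theorem MCDomain.isCompact_frontier (D : MCDomain n) : IsCompact (frontier D.Ω) :=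
  D.isCompact_closure.of_isClosed_subset isClosed_frontier frontier_subset_closure

theorem IsBoundaryMap.ae_radial {Ω : Set ℂ} (hτb : IsBoundaryMap Ω τ τb) :
    ∀ᵐ ζ ∂circleMeasure, Tendsto (fun r : ℝ => τ (r * ζ)) (𝓝[<] 1) (𝓝 (τb ζ)) ∧
      τb ζ ∈ frontier Ω := by
  filter_upwards [hτb.2, ae_circleMeasure_norm] with ζ h hζ using ⟨h.1.radial hζ, h.2⟩

theorem MCDomain.re_comp_eq_integral (D : MCDomain n) (hτ : IsCoveringOfDisk D.Ω D.w₀ τ)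
    (hτb : IsBoundaryMap D.Ω τ τb) {B : ℂ → ℂ}
    (hB : ∀ w ∈ closure D.Ω, DifferentiableAt ℂ B w) {z : ℂ} (hz : z ∈ ball (0 : ℂ) 1) :
    (B (τ z)).re = ∫ ζ, (B (τb ζ)).re ∂poissonMeasure z := by
  obtain ⟨M, hM⟩ := D.isCompact_closure.exists_bound_of_continuousOn
    fun w hw => (hB w hw).continuousAt.continuousWithinAt
  have hcl : ∀ v ∈ ball (0 : ℂ) 1, τ v ∈ closure D.Ω := fun v hv =>
    subset_closure (hτ.mapsTo v hv)
  refine re_eq_integral_of_radial_limit (H := fun v => B (τ v)) (fun v hv => ?_)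
    (fun v hv => (abs_re_le_norm _).trans (hM _ (hcl v hv))) ?_ hz
  · exact ((hB _ (hcl v hv)).comp v
      (hτ.diff.differentiableAt (isOpen_ball.mem_nhds hv))).differentiableWithinAt
  · filter_upwards [hτb.ae_radial] with ζ hζ
    exact ((continuous_re.continuousAt.comp
      (hB _ (frontier_subset_closure hζ.2)).continuousAt).tendsto).comp hζ.1

/-- The Poisson extension to the disc of a function on the boundary of `Ω`. -/
def poissonExtension (τb : ℂ → ℂ) (φ : BoundedContinuousFunction ℂ ℝ) (z : ℂ) : ℝ :=
  ∫ ζ, φ (τb ζ) ∂poissonMeasure z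

theorem integrable_boundary_comp (hτb : Measurable τb) (φ : BoundedContinuousFunction ℂ ℝ)
    (μ : Measure ℂ) [IsFiniteMeasure μ] : Integrable (fun ζ => φ (τb ζ)) μ :=
  Integrable.of_bound (φ.continuous.measurable.comp hτb).aestronglyMeasurable ‖φ‖
    (Eventually.of_forall fun _ => φ.norm_coe_le_norm _)

theorem abs_poissonExtension_le (φ : BoundedContinuousFunction ℂ ℝ) {z : ℂ}
    (hz : z ∈ ball (0 : ℂ) 1) : |poissonExtension τb φ z| ≤ ‖φ‖ := by
  have := isProbabilityMeasure_poissonMeasure hz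
  have h := norm_integral_le_of_norm_le_const (μ := poissonMeasure z)
    (Eventually.of_forall fun ζ => φ.norm_coe_le_norm (τb ζ))
  simpa [poissonExtension] using h

theorem MCDomain.exists_abs_poissonExtension_sub_lt (D : MCDomain n)
    (hτ : IsCoveringOfDisk D.Ω D.w₀ τ) (hτb : IsBoundaryMap D.Ω τ τb)
    (φ : BoundedContinuousFunction ℂ ℝ) {ζ₀ : ℂ} (hζ₀ : ζ₀ ∈ frontier D.Ω) {ε : ℝ} (hε : 0 < ε) :
    ∃ δ > 0, ∀ z ∈ ball (0 : ℂ) 1, ‖τ z - ζ₀‖ < δ → |poissonExtension τb φ z - φ ζ₀| < ε := by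
  obtain ⟨B, hBm, hB, hB0, hpos⟩ := D.exists_barrier hζ₀
  have hBc : ContinuousOn (fun w => (B w).re) (frontier D.Ω) := fun w hw =>
    (continuous_re.continuousAt.comp
      (hB w (frontier_subset_closure hw)).continuousAt).continuousWithinAt
  have hnn : ∀ w ∈ frontier D.Ω, 0 ≤ (B w).re := fun w hw => by
    by_cases h : w = ζ₀
    · simp [h, hB0]
    · exact (hpos w (frontier_subset_closure hw) h).le
  obtain ⟨C, hC, hle⟩ := exists_abs_sub_le_add_mul D.isCompact_frontier φ.continuous.continuousOn
    hζ₀ hBc hnn (fun w hw h => hpos w (frontier_subset_closure hw) h) (half_pos hε)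
  have hBζ : Tendsto (fun w => C * (B w).re) (𝓝 ζ₀) (𝓝 0) := by
    have h := (continuous_re.continuousAt.comp
      (hB ζ₀ (frontier_subset_closure hζ₀)).continuousAt).tendsto.const_mul C
    simpa [hB0, Function.comp_def] using h
  obtain ⟨δ, hδ, hlt⟩ := Metric.eventually_nhds_iff_ball.1
    (hBζ.eventually (gt_mem_nhds (half_pos hε)))
  refine ⟨δ, hδ, fun z hz hzδ => ?_⟩
  have := isProbabilityMeasure_poissonMeasure hz
  have hac := poissonMeasure_absolutelyContinuous z
  have hInteg : Integrable (fun ζ => φ (τb ζ)) (poissonMeasure z) :=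
    integrable_boundary_comp hτb.1 φ _
  obtain ⟨M, hM⟩ := D.isCompact_frontier.exists_bound_of_continuousOn hBc
  have hfr : ∀ᵐ ζ ∂poissonMeasure z, _ := hac.ae_le hτb.2
  have hintB : Integrable (fun ζ => (B (τb ζ)).re) (poissonMeasure z) :=
    Integrable.of_bound (measurable_re.comp (hBm.comp hτb.1)).aestronglyMeasurable M
      (hfr.mono fun ζ hζ => hM _ hζ.2)
  calc |poissonExtension τb φ z - φ ζ₀|
      = |∫ ζ, (φ (τb ζ) - φ ζ₀) ∂poissonMeasure z| := by
        rw [integral_sub hInteg (integrable_const _)]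
        simp [poissonExtension]
    _ ≤ ∫ ζ, |φ (τb ζ) - φ ζ₀| ∂poissonMeasure z := abs_integral_le_integral_abs
    _ ≤ ∫ ζ, (ε / 2 + C * (B (τb ζ)).re) ∂poissonMeasure z := by
        refine integral_mono_ae (hInteg.sub (integrable_const _)).abs
          ((integrable_const _).add (hintB.const_mul C)) ?_
        filter_upwards [hfr] with ζ hζ using hle _ hζ.2
    _ = ε / 2 + C * (B (τ z)).re := by
        rw [integral_add (integrable_const _) (hintB.const_mul C), integral_const_mul,
          ← D.re_comp_eq_integral hτ hτb hB hz]
        simp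
    _ < ε := by
        have := hlt (τ z) (by rwa [mem_ball, dist_eq_norm])
        linarith

theorem MCDomain.poissonExtension_eq_of_eq (D : MCDomain n)
    (hτ : IsCoveringOfDisk D.Ω D.w₀ τ) (hτb : IsBoundaryMap D.Ω τ τb)
    (φ : BoundedContinuousFunction ℂ ℝ) {z₁ z₂ : ℂ} (hz₁ : z₁ ∈ ball (0 : ℂ) 1)
    (hz₂ : z₂ ∈ ball (0 : ℂ) 1) (h : τ z₁ = τ z₂) :
    poissonExtension τb φ z₁ = poissonExtension τb φ z₂ := by
  obtain ⟨s, hs, hs1, hsτ, hsz⟩ := hτ.exists_lift isOpen_ball (convex_ball 0 1) hτ.diff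
    hτ.mapsTo hz₁ hz₂ h.symm
  obtain ⟨H, hH, hHre⟩ := exists_holomorphic_re_eq_integral
    (integrable_boundary_comp hτb.1 φ circleMeasure)
  have hHre : ∀ z ∈ ball (0 : ℂ) 1, (H z).re = poissonExtension τb φ z := hHre
  have hlim : ∀ z : ℝ → ℂ, ∀ ζ₀ ∈ frontier D.Ω, (∀ᶠ r in 𝓝[<] 1, z r ∈ ball (0 : ℂ) 1) →
      Tendsto (fun r => τ (z r)) (𝓝[<] 1) (𝓝 ζ₀) →
      Tendsto (fun r => (H (z r)).re) (𝓝[<] 1) (𝓝 (φ ζ₀)) := by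
    intro z ζ₀ hζ₀ hzb hzt
    refine Metric.tendsto_nhds.2 fun ε hε => ?_
    obtain ⟨δ, hδ, hlt⟩ := D.exists_abs_poissonExtension_sub_lt hτ hτb φ hζ₀ hε
    filter_upwards [hzb, hzt (ball_mem_nhds ζ₀ hδ)] with r hr hrδ
    rw [hHre _ hr, Real.dist_eq]
    exact hlt _ hr (by simpa [dist_eq_norm] using hrδ)
  have key := re_eq_integral_of_radial_limit (H := fun z => H (s z) - H z) (V := fun _ => 0)
    (C := ‖φ‖ + ‖φ‖) ((hH.comp hs hs1).sub hH) (fun z hz => ?_) ?_ hz₁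
  · rw [hsz, sub_re, hHre _ hz₁, hHre _ hz₂, integral_zero] at key
    linarith
  · rw [sub_re, hHre _ hz, hHre _ (hs1 z hz)]
    exact (abs_sub _ _).trans (add_le_add (abs_poissonExtension_le φ (hs1 z hz))
      (abs_poissonExtension_le φ hz))
  · filter_upwards [hτb.ae_radial, ae_circleMeasure_norm] with ζ hζ hζ1
    have hev : ∀ᶠ r : ℝ in 𝓝[<] 1, (r : ℂ) * ζ ∈ ball (0 : ℂ) 1 := by
      filter_upwards [Ioo_mem_nhdsLT (zero_lt_one' ℝ)] with r hr
      rw [mem_ball_zero_iff, norm_mul, hζ1, mul_one, norm_real, Real.norm_of_nonneg hr.1.le]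
      exact hr.2
    have h₁ := hlim (fun r => r * ζ) _ hζ.2 hev hζ.1
    have h₂ := hlim (fun r => s (r * ζ)) _ hζ.2 (hev.mono fun r hr => hs1 _ hr)
      (hζ.1.congr' (hev.mono fun r hr => (hsτ _ hr).symm))
    simpa using h₂.sub h₁

theorem MCDomain.exists_dirichlet_solution (D : MCDomain n)
    (hτ : IsCoveringOfDisk D.Ω D.w₀ τ) (hτb : IsBoundaryMap D.Ω τ τb)
    (φ : BoundedContinuousFunction ℂ ℝ) :
    ∃ u : ℂ → ℝ, (∀ z ∈ ball (0 : ℂ) 1, u (τ z) = poissonExtension τb φ z) ∧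
      (∀ w ∉ D.Ω, u w = φ w) ∧ IsHarmonicOn u D.Ω ∧ ContinuousOn u (closure D.Ω) := by
  classical
  choose! p hp hpτ using fun w (hw : w ∈ D.Ω) => hτ.surj hw
  set u : ℂ → ℝ := fun w => if w ∈ D.Ω then poissonExtension τb φ (p w) else φ w with hu
  have huτ : ∀ z ∈ ball (0 : ℂ) 1, u (τ z) = poissonExtension τb φ z := fun z hz => by
    have hm := hτ.mapsTo z hz
    rw [hu]
    simp only [hm, if_true]
    exact D.poissonExtension_eq_of_eq hτ hτb φ (hp _ hm) hz (hpτ _ hm)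
  have huφ : ∀ w ∉ D.Ω, u w = φ w := fun w hw => if_neg hw
  obtain ⟨H, hH, hHre⟩ := exists_holomorphic_re_eq_integral
    (integrable_boundary_comp hτb.1 φ circleMeasure)
  have hharm : IsHarmonicOn u D.Ω := by
    intro w hw
    obtain ⟨r, hr, hsub⟩ := Metric.isOpen_iff.1 D.isOpen w hw
    obtain ⟨s, hs, hs1, hsτ, -⟩ := hτ.exists_lift isOpen_ball (convex_ball w r)
      (k := fun v => v) differentiableOn_id hsub (mem_ball_self hr) (hp w hw) (hpτ w hw)
    refine ⟨r, hr, hsub, fun v => H (s v), hH.comp hs hs1, fun v hv => ?_⟩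
    rw [hHre _ (hs1 v hv), ← hsτ v hv, huτ _ (hs1 v hv), hsτ v hv]
    rfl
  refine ⟨u, huτ, huφ, hharm, fun w hw => ?_⟩
  by_cases hwΩ : w ∈ D.Ω
  · obtain ⟨r, hr, hsub, g, hg, hgu⟩ := hharm w hwΩ
    refine ContinuousAt.continuousWithinAt ?_
    refine ContinuousAt.congr (f := fun v => (g v).re) ?_
      (by filter_upwards [ball_mem_nhds w hr] with v hv using (hgu v hv).symm)
    exact continuous_re.continuousAt.comp
      (hg.differentiableAt (ball_mem_nhds w hr)).continuousAt
  · have hwf : w ∈ frontier D.Ω := by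
      rw [D.isOpen.frontier_eq]
      exact ⟨hw, hwΩ⟩
    refine Metric.tendsto_nhds.2 fun ε hε => ?_
    obtain ⟨δ, hδ, hlt⟩ := D.exists_abs_poissonExtension_sub_lt hτ hτb φ hwf hε
    refine eventually_nhdsWithin_of_eventually_nhds ?_
    filter_upwards [ball_mem_nhds w hδ,
      Metric.tendsto_nhds.1 (φ.continuous.tendsto w) ε hε] with v hv hv'
    rw [huφ w hwΩ]
    by_cases hvΩ : v ∈ D.Ω
    · rw [← hpτ v hvΩ, huτ _ (hp v hvΩ), Real.dist_eq]
      exact hlt _ (hp v hvΩ) (by rwa [hpτ v hvΩ, ← dist_eq_norm])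
    · rwa [huφ v hvΩ]

/-- Harmonic measure is the image of Poisson measure under the boundary map. -/
theorem MCDomain.ωm_eq_map (D : MCDomain n) (hτ : IsCoveringOfDisk D.Ω D.w₀ τ)
    (hτb : IsBoundaryMap D.Ω τ τb) {z : ℂ} (hz : z ∈ ball (0 : ℂ) 1) :
    D.ωm (τ z) = Measure.map τb (poissonMeasure z) := by
  have hm := hτ.mapsTo z hz
  have := D.prob _ hm
  have := isProbabilityMeasure_poissonMeasure hz
  have : IsFiniteMeasure (Measure.map τb (poissonMeasure z)) :=
    Measure.isFiniteMeasure_map _ _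
  refine ext_of_forall_integral_eq_of_IsFiniteMeasure fun φ => ?_
  obtain ⟨u, huτ, huφ, hharm, hcont⟩ := D.exists_dirichlet_solution hτ hτb φ
  rw [integral_map hτb.1.aemeasurable φ.continuous.aestronglyMeasurable]
  change _ = poissonExtension τb φ z
  rw [← huτ z hz, D.dirichlet u hcont hharm _ hm]
  refine integral_congr_ae ?_
  have hsupp : ∀ᵐ ζ ∂D.ωm (τ z), ζ ∈ frontier D.Ω := D.supp _ hm
  filter_upwards [hsupp] with ζ hζ
  rw [D.isOpen.frontier_eq] at hζ
  exact (huφ ζ hζ.2).symm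

end HarmonicMeasure

section OuterFunctions

variable {τ τb : ℂ → ℂ}

theorem exists_holomorphic_re_eq_comp {Ω : Set ℂ} {w₀ : ℂ} (hτ : IsCoveringOfDisk Ω w₀ τ)
    {h : ℂ → ℝ} (hh : IsHarmonicOn h Ω) :
    ∃ H : ℂ → ℂ, DifferentiableOn ℂ H (ball 0 1) ∧ ∀ z ∈ ball (0 : ℂ) 1, (H z).re = h (τ z) := by
  have hharm : InnerProductSpace.HarmonicOnNhd (fun z => h (τ z)) (ball (0 : ℂ) 1) := by
    intro z hz
    obtain ⟨r, hr, hsub, g, hg, hgu⟩ := hh _ (hτ.mapsTo z hz)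
    have hτa : AnalyticAt ℂ τ z := hτ.diff.analyticAt (isOpen_ball.mem_nhds hz)
    have hga : AnalyticAt ℂ (fun v => g (τ v)) z :=
      (hg.analyticAt (ball_mem_nhds _ hr)).comp hτa
    refine (InnerProductSpace.harmonicAt_congr_nhds ?_).2 hga.harmonicAt_re
    filter_upwards [hτa.continuousAt (ball_mem_nhds (τ z) hr)] with v hv using hgu _ hv
  obtain ⟨H, hH, hre⟩ := hharm.exists_analyticOnNhd_ball_re_eq
  exact ⟨H, hH.differentiableOn, fun z hz => hre hz⟩

theorem MCDomain.ae_ntLim_comp (D : MCDomain n) (hτ : IsCoveringOfDisk D.Ω D.w₀ τ)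
    (hτb : IsBoundaryMap D.Ω τ τb) (hpush : D.ω = Measure.map τb circleMeasure) {f g : ℂ → ℂ}
    (hg : ∀ᵐ ζ ∂D.ω, NTLim D.Ω g ζ (f ζ)) :
    ∀ᵐ ζ ∂circleMeasure, NTLim (ball 0 1) (fun z => g (τ z)) ζ (f (τb ζ)) := by
  rw [hpush] at hg
  filter_upwards [ae_of_ae_map hτb.1.aemeasurable hg, hτb.2, ae_circleMeasure_norm]
    with ζ h₁ h₂ h₃ using D.ntLim_comp hτ h₃ h₂.2 h₂.1 h₁

theorem MCDomain.integral_log_eq (D : MCDomain n) (hτ : IsCoveringOfDisk D.Ω D.w₀ τ)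
    (hτb : IsBoundaryMap D.Ω τ τb) {f : ℂ → ℂ} (hf : Measurable f) {z : ℂ}
    (hz : z ∈ ball (0 : ℂ) 1) :
    ∫ ζ, Real.log ‖f ζ‖ ∂(D.ωm (τ z)) = ∫ ζ, Real.log ‖f (τb ζ)‖ ∂(poissonMeasure z) := by
  rw [D.ωm_eq_map hτ hτb hz, integral_map hτb.1.aemeasurable
    (Measurable.aestronglyMeasurable (by fun_prop))]

theorem exists_norm_le_exp_re {G : ℂ → ℂ} {k : ℂ → ℝ}
    (hG : ∀ z ∈ ball (0 : ℂ) 1, Real.log ‖G z‖ = ∫ ζ, k ζ ∂poissonMeasure z) :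
    ∃ H : ℂ → ℂ, DifferentiableOn ℂ H (ball 0 1) ∧
      ∀ z ∈ ball (0 : ℂ) 1, 0 ≤ (H z).re ∧ ‖G z‖ ≤ Real.exp (H z).re := by
  by_cases hk : Integrable k circleMeasure
  · obtain ⟨H, hH, hre⟩ := exists_holomorphic_re_eq_integral hk.abs
    refine ⟨H, hH, fun z hz => ⟨?_, ?_⟩⟩
    · rw [hre z hz]
      exact integral_nonneg fun ζ => abs_nonneg _
    · refine (Real.le_exp_log _).trans (Real.exp_le_exp.2 ?_)
      rw [hG z hz, hre z hz]
      exact (le_abs_self _).trans abs_integral_le_integral_abs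
  · refine ⟨0, differentiableOn_const 0, fun z hz => ⟨by simp, ?_⟩⟩
    refine (Real.le_exp_log _).trans (Real.exp_le_exp.2 ?_)
    rw [hG z hz, integral_undef (mt (integrable_poissonMeasure_iff_circleMeasure hz).1 hk)]
    simp

/-- Uniqueness for functions of the Nevanlinna class with equal nontangential limits. -/
theorem eq_of_ae_ntLim_eq {G G₀ H H₀ : ℂ → ℂ} {ψ : ℂ → ℂ} (hG : DifferentiableOn ℂ G (ball 0 1))
    (hG₀ : DifferentiableOn ℂ G₀ (ball 0 1)) (hH : DifferentiableOn ℂ H (ball 0 1))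
    (hH₀ : DifferentiableOn ℂ H₀ (ball 0 1))
    (hb : ∀ z ∈ ball (0 : ℂ) 1, 0 ≤ (H z).re ∧ ‖G z‖ ≤ Real.exp (H z).re)
    (hb₀ : ∀ z ∈ ball (0 : ℂ) 1, ‖G₀ z‖ ≤ (H₀ z).re)
    (hlim : ∀ᵐ ζ ∂circleMeasure, NTLim (ball 0 1) G ζ (ψ ζ))
    (hlim₀ : ∀ᵐ ζ ∂circleMeasure, NTLim (ball 0 1) G₀ ζ (ψ ζ)) {z : ℂ}
    (hz : z ∈ ball (0 : ℂ) 1) : G z = G₀ z := by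
  have hE : ∀ v, ‖cexp (-H v - H₀ v)‖ = Real.exp (-(H v).re - (H₀ v).re) := fun v => by
    rw [norm_exp, sub_re, neg_re]
  have hR₀ : ∀ v ∈ ball (0 : ℂ) 1, 0 ≤ (H₀ v).re := fun v hv => (norm_nonneg _).trans (hb₀ v hv)
  have key := eq_zero_of_radial_limit (Φ := fun v => (G v - G₀ v) * cexp (-H v - H₀ v)) (C := 2)
    ((hG.sub hG₀).mul (hH.neg.sub hH₀).cexp) (fun v hv => ?_) ?_ hz
  · exact sub_eq_zero.1 ((mul_eq_zero.1 key).resolve_right (exp_ne_zero _))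
  · rw [norm_mul, hE]
    have h₁ : ‖G v - G₀ v‖ ≤ 2 * Real.exp ((H v).re + (H₀ v).re) := by
      have h₂ := Real.exp_le_exp.2 (le_add_of_nonneg_right (hR₀ v hv) : (H v).re ≤ _)
      have h₃ := Real.add_one_le_exp ((H v).re + (H₀ v).re)
      linarith [norm_sub_le (G v) (G₀ v), hb v hv, hb₀ v hv]
    calc _ ≤ 2 * Real.exp ((H v).re + (H₀ v).re) * Real.exp (-(H v).re - (H₀ v).re) := by gcongr
      _ = 2 := by
        rw [mul_assoc, ← Real.exp_add, show (H v).re + (H₀ v).re + (-(H v).re - (H₀ v).re) = 0 by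
          ring, Real.exp_zero, mul_one]
  · filter_upwards [hlim, hlim₀, ae_circleMeasure_norm] with ζ h₁ h₂ hζ
    have h₃ := ((h₁.radial hζ).sub (h₂.radial hζ)).norm
    rw [sub_self, norm_zero] at h₃
    refine squeeze_zero_norm' ?_ h₃
    filter_upwards [Ioo_mem_nhdsLT (zero_lt_one' ℝ)] with r hr
    have hm : (r : ℂ) * ζ ∈ ball (0 : ℂ) 1 := by
      rw [mem_ball_zero_iff, norm_mul, hζ, mul_one, norm_real, Real.norm_of_nonneg hr.1.le]
      exact hr.2
    rw [norm_mul, hE]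
    refine mul_le_of_le_one_right (norm_nonneg _) (Real.exp_le_one_iff.2 ?_)
    linarith [hR₀ _ hm, (hb _ hm).1]

end OuterFunctions

/- STATEMENT 8: f ∈ H¹(Γ) is outer (in Royden's sense) iff f ∘ τ is outer in H¹(𝕋). -/
theorem outer_iff_comp_tau_outer {n : ℕ} (D : MCDomain n)
    (τ τb : ℂ → ℂ) (hτ : IsCoveringOfDisk D.Ω D.w₀ τ) (hτb : IsBoundaryMap D.Ω τ τb)
    (hpush : D.ω = Measure.map τb circleMeasure) :
    ∀ f : ℂ → ℂ, f ∈ D.H1 → Measurable f →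
      (D.IsOuter f ↔ DiskOuter (fun ζ => f (τb ζ))) := by
  intro f hf hfm
  constructor
  · rintro ⟨g, hg, hlim, hlog⟩
    refine ⟨fun z => g (τ z), hg.comp hτ.diff hτ.mapsTo,
      D.ae_ntLim_comp hτ hτb hpush hlim, fun z hz => ?_⟩
    rw [hlog _ (hτ.mapsTo z hz), D.integral_log_eq hτ hτb hfm hz]
  · rintro ⟨G, hG, hlim, hlog⟩
    obtain ⟨g, hg, ⟨h, hh, hgh⟩, hglim⟩ := hf
    obtain ⟨H₀, hH₀, hre⟩ := exists_holomorphic_re_eq_comp hτ hh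
    obtain ⟨H, hH, hb⟩ := exists_norm_le_exp_re hlog
    have heq : ∀ z ∈ ball (0 : ℂ) 1, G z = g (τ z) := fun z hz =>
      eq_of_ae_ntLim_eq hG (hg.comp hτ.diff hτ.mapsTo) hH hH₀ hb
        (fun v hv => (hre v hv).symm ▸ hgh _ (hτ.mapsTo v hv)) hlim
        (D.ae_ntLim_comp hτ hτb hpush hglim) hz
    refine ⟨g, hg, hglim, fun w hw => ?_⟩
    obtain ⟨z, hz, rfl⟩ := hτ.surj hw
    rw [← heq z hz, hlog z hz, D.integral_log_eq hτ hτb hfm hz]
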